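/- arXiv:1407.1305 — 4 statements merged into one kernel-verified Lean document; each statement's English description precedes it below -/
import Mathlib

section
/- If K is an infinite field of characteristic p > 2, then T_2(E_{0*}⊗E_0) = I_p; that is, the 2-graded identities of E_{0*}⊗E_0 follow from the polynomials (1)–(7) together with the polynomials (8) and (9). -/
open scoped TensorProduct

noncomputable section

namespace Paper

variable (K : Type) [Field K]

/-- The Grassmann algebra `E` of a vector space with countable basis. -/
abbrev E := ExteriorAlgebra K (ℕ →₀ K)

/-- The generators `e_i` of the Grassmann algebra (0-based indexing). -/
def eGen (i : ℕ) : E K := ExteriorAlgebra.ι K (Finsupp.single i 1)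

/-- The basis monomial `e_{i_1} ⋯ e_{i_k}` of `E`, `i_1 < ⋯ < i_k`, indexed by a finite set. -/
def eMon (s : Finset ℕ) : E K := ((s.sort (· ≤ ·)).map (eGen K)).prod

/-- The algebra `A = E ⊗ E`. -/
abbrev A := E K ⊗[K] E K

/-- The canonical basis of `E ⊗ E`, indexed by pairs of finite sets (= supports). -/
def bEE (q : Finset ℕ × Finset ℕ) : A K := eMon K q.1 ⊗ₜ[K] eMon K q.2

/-- The `ℤ₂ × ℤ₂`-degree of a canonical basis element in the canonical grading of `E ⊗ E`. -/
def gdeg (q : Finset ℕ × Finset ℕ) : ZMod 2 × ZMod 2 :=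
  ((q.1.card : ZMod 2), (q.2.card : ZMod 2))

/-- The homogeneous component of degree `g` of the canonical `ℤ₂ × ℤ₂`-grading of `E ⊗ E`. -/
def Acomp (g : ZMod 2 × ZMod 2) : Submodule K (A K) :=
  Submodule.span K { a | ∃ q, gdeg q = g ∧ a = bEE K q }

/-- Degree of a basis monomial of `E ⊗ E` in the `ℤ₂`-grading induced by weight functions
`w₁, w₂` on the generators of the two factors. -/
def wdeg (w₁ w₂ : ℕ → ZMod 2) (q : Finset ℕ × Finset ℕ) : ZMod 2 :=
  (∑ i ∈ q.1, w₁ i) + (∑ j ∈ q.2, w₂ j)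

/-- Homogeneous component of degree `δ` of the `ℤ₂`-grading of `E ⊗ E` induced by weights. -/
def Agr (w₁ w₂ : ℕ → ZMod 2) (δ : ZMod 2) : Submodule K (A K) :=
  Submodule.span K { a | ∃ q, wdeg w₁ w₂ q = δ ∧ a = bEE K q }

/-- Weights for `E_∞`:  `‖e_i‖ = 1` iff `i` is even (paper's 1-based `e_i` is our `i-1`). -/
def wInf : ℕ → ZMod 2 := fun i => if i % 2 = 1 then 1 else 0

/-- Weights for `E_{k*}`:  `‖e_i‖ = 1` for `i ≤ k`, else `0`. -/
def wKstar (k : ℕ) : ℕ → ZMod 2 := fun i => if i < k then 1 else 0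

/-- Weights for `E_k`:  `‖e_i‖ = 0` for `i ≤ k`, else `1`. -/
def wK (k : ℕ) : ℕ → ZMod 2 := fun i => if i < k then 0 else 1

/-- The `ℤ₂`-grading `E_{0*} ⊗ E_0` of `A = E ⊗ E`: `A₀ = E⊗E⁰`, `A₁ = E⊗E¹`. -/
def A0star (δ : ZMod 2) : Submodule K (A K) := Agr K (wKstar 0) (wK 0) δ

/-- The free associative algebra `K⟨Y ∪ Z⟩`: variable `(false, i)` is `y_i`,
variable `(true, i)` is `z_i`. -/
abbrev FA := FreeAlgebra K (Bool × ℕ)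

/-- The even variables `y_i`. -/
def Yv (i : ℕ) : FA K := FreeAlgebra.ι K (false, i)

/-- The odd variables `z_i`. -/
def Zv (i : ℕ) : FA K := FreeAlgebra.ι K (true, i)

/-- The Jordan product `a ∘ b = ab + ba`. -/
def circ {R : Type*} [Ring R] (a b : R) : R := a * b + b * a

/-- Substitution `y_i ↦ a i`, `z_i ↦ z i` as an algebra homomorphism. -/
def ev {B : Type*} [Ring B] [Algebra K B] (a z : ℕ → B) : FA K →ₐ[K] B :=
  FreeAlgebra.lift K (fun v => if v.1 then z v.2 else a v.2)

/-- `f` is a 2-graded polynomial identity of the `ℤ₂`-graded algebra `B = B₀ ⊕ B₁`. -/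
def GIdent {B : Type*} [Ring B] [Algebra K B] (B0 B1 : Submodule K B) (f : FA K) : Prop :=
  ∀ a z : ℕ → B, (∀ i, a i ∈ B0) → (∀ i, z i ∈ B1) → ev K a z f = 0

/-- `f` is an ordinary polynomial identity of `B`. -/
def OIdent (B : Type) [Ring B] [Algebra K B] (f : FA K) : Prop :=
  ∀ u : Bool × ℕ → B, FreeAlgebra.lift K u f = 0

/-- The homogeneous component of degree `δ` of the free algebra `K⟨Y ∪ Z⟩`
(span of the monomials whose number of odd variables has parity `δ`). -/
def FAdeg (δ : ZMod 2) : Submodule K (FA K) :=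
  Submodule.span K { w | ∃ l : List (Bool × ℕ),
    ((l.countP (fun v => v.1) : ℕ) : ZMod 2) = δ ∧ w = (l.map (FreeAlgebra.ι K)).prod }

/-- A grading-preserving endomorphism of the free algebra `K⟨Y ∪ Z⟩`. -/
def GradedEndo (φ : FA K →ₐ[K] FA K) : Prop :=
  (∀ i, φ (Yv K i) ∈ FAdeg K 0) ∧ (∀ i, φ (Zv K i) ∈ FAdeg K 1)

/-- A two-sided ideal of `K⟨Y ∪ Z⟩` is a `T₂`-ideal if it is invariant under all
grading-preserving endomorphisms. -/
def IsT2Ideal (J : TwoSidedIdeal (FA K)) : Prop :=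
  ∀ φ : FA K →ₐ[K] FA K, GradedEndo K φ → ∀ x ∈ J, φ x ∈ J

/-- The `T₂`-ideal generated by a set `S`: the smallest two-sided ideal containing `S`
and invariant under all grading-preserving endomorphisms. -/
def T2IdealGen (S : Set (FA K)) : TwoSidedIdeal (FA K) :=
  sInf { J | S ⊆ J ∧ IsT2Ideal K J }

/-- The generators (1)–(7) of the `T₂`-ideal `I`. -/
def gens : Set (FA K) :=
  { ⁅⁅Yv K 1, Yv K 2⁆, Yv K 3⁆, ⁅⁅Yv K 1, Yv K 2⁆, Zv K 3⁆,
    ⁅⁅Yv K 1, Zv K 2⁆, Yv K 3⁆,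
    circ ⁅Yv K 1, Zv K 2⁆ (Zv K 3),
    ⁅circ (Zv K 1) (Zv K 2), Zv K 3⁆,
    circ (Zv K 1) (Zv K 2) * circ (Zv K 3) (Zv K 4)
      - circ (Zv K 1) (Zv K 3) * circ (Zv K 2) (Zv K 4),
    ⁅Yv K 1, Yv K 2⁆ * ⁅Yv K 3, Yv K 4⁆ + ⁅Yv K 1, Yv K 3⁆ * ⁅Yv K 2, Yv K 4⁆,
    ⁅Yv K 1, Yv K 2⁆ * ⁅Yv K 3, Zv K 4⁆ + ⁅Yv K 1, Yv K 3⁆ * ⁅Yv K 2, Zv K 4⁆,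
    ⁅Zv K 1, Yv K 2⁆ * ⁅Yv K 3, Yv K 4⁆ + ⁅Zv K 1, Yv K 3⁆ * ⁅Yv K 2, Yv K 4⁆,
    ⁅Zv K 1, Yv K 2⁆ * ⁅Yv K 3, Zv K 4⁆ + ⁅Zv K 1, Yv K 3⁆ * ⁅Yv K 2, Zv K 4⁆,
    ⁅Yv K 1, Zv K 2⁆ * circ (Zv K 3) (Zv K 4) - ⁅Yv K 1, Zv K 3⁆ * circ (Zv K 2) (Zv K 4) }

/-- The product `[y_1, z_1][y_2, z_1] ⋯ [y_k, z_1]`. -/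
def prodYZ (k : ℕ) : FA K := ((List.range k).map (fun i => ⁅Yv K (i + 1), Zv K 1⁆)).prod

/-- The generators (1)–(7) together with (8) and (9) of the `T₂`-ideal `I_p`. -/
def gensP (p : ℕ) : Set (FA K) :=
  gens K ∪ { f | ∃ n k : ℕ, 1 ≤ k ∧ 2 * n + 2 * k - 1 = p ∧
    (f = prodYZ K (2 * k - 2) * circ (Zv K 2) (Zv K 1) * (Zv K 1) ^ (2 * n) ∨
     f = prodYZ K (2 * k - 1) * (Zv K 1) ^ (2 * n)) }

/-- The polynomial `h = h_y · h_{y,z} · h_z`, given by the lists of index pairs of the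
commutators `[y,y]`, the commutators `[y,z]` and the Jordan products `z ∘ z`. -/
def hpoly (ly lyz lz : List (ℕ × ℕ)) : FA K :=
  (ly.map (fun p => ⁅Yv K p.1, Yv K p.2⁆)).prod *
  (lyz.map (fun p => ⁅Yv K p.1, Zv K p.2⁆)).prod *
  (lz.map (fun p => circ (Zv K p.1) (Zv K p.2))).prod

/-- The list `i_1, …, i_{2m+n}` of indices of the even variables occurring in `h`. -/
def yIdx (ly lyz : List (ℕ × ℕ)) : List ℕ :=
  (ly.flatMap fun p => [p.1, p.2]) ++ lyz.map Prod.fst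

/-- The list `j_1, …, j_{n+2p}` of indices of the odd variables occurring in `h`. -/
def zIdx (lyz lz : List (ℕ × ℕ)) : List ℕ :=
  lyz.map Prod.snd ++ (lz.flatMap fun p => [p.1, p.2])

/-- A left-normed higher commutator of variables `[x_{v}, x_{w}, x_{u_1}, …]` (length ≥ 2). -/
def commList (v w : Bool × ℕ) (l : List (Bool × ℕ)) : FA K :=
  l.foldl (fun acc u => ⁅acc, FreeAlgebra.ι K u⁆) ⁅FreeAlgebra.ι K v, FreeAlgebra.ι K w⁆

/-- The generators of the subalgebra `B(Y,Z)` of `Y`-proper polynomials: the odd variables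
and the nontrivial higher commutators of variables. -/
def ProperGens : Set (FA K) :=
  Set.range (Zv K) ∪ { c | ∃ v w l, c = commList K v w l }

end Paper

namespace Paper

section SignEq

variable {R : Type*} [Ring R]

/-- Equality up to a sign. -/
def SignEq (a b : R) : Prop := a = b ∨ a = -b

theorem SignEq.refl (a : R) : SignEq a a := Or.inl rfl

theorem SignEq.trans {a b c : R} (h : SignEq a b) (h' : SignEq b c) : SignEq a c := by
  rcases h with rfl | rfl <;> rcases h' with rfl | rfl <;> simp [SignEq]

theorem SignEq.mul_left (x : R) {a b : R} (h : SignEq a b) : SignEq (x * a) (x * b) := by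
  rcases h with rfl | rfl <;> simp [SignEq]

theorem SignEq.eq_zero {a b : R} (h : SignEq a b) (hb : b = 0) : a = 0 := by
  rcases h with rfl | rfl <;> simp [hb]

end SignEq

section Blocks

variable {R S : Type*} [Ring R] [Ring S]

/-- The product `(z_{j₁} ∘ z_{j₂}) (z_{j₃} ∘ z_{j₄}) ⋯`; zero for lists of odd length. -/
def zblk (z : ℕ → R) : List ℕ → R
  | [] => 1
  | [_] => 0
  | i :: j :: M => circ (z i) (z j) * zblk z M

/-- The product of commutators `[y, y]`, at most one commutator `[y, z]`, and Jordan products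
`z ∘ z`, in which the even (odd) variables occur in the order of the first (second) list;
zero if the lengths of the lists have different parities. -/
def blk (y z : ℕ → R) : List ℕ → List ℕ → R
  | [], M => zblk z M
  | [_], [] => 0
  | [i], j :: M => ⁅y i, z j⁆ * zblk z M
  | i :: j :: L, M => ⁅y i, y j⁆ * blk y z L M

theorem map_circ {F : Type*} [FunLike F R S] [RingHomClass F R S] (φ : F) (a b : R) :
    φ (circ a b) = circ (φ a) (φ b) := by
  simp [circ]

theorem map_lie_ring {F : Type*} [FunLike F R S] [RingHomClass F R S] (φ : F) (a b : R) :
    φ ⁅a, b⁆ = ⁅φ a, φ b⁆ := by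
  simp [Ring.lie_def]

theorem map_zblk (φ : R →+* S) (z : ℕ → R) :
    ∀ M, φ (zblk z M) = zblk (fun i => φ (z i)) M
  | [] => by simp [zblk]
  | [_] => by simp [zblk]
  | i :: j :: M => by simp [zblk, map_zblk φ z M, map_circ]

theorem map_blk (φ : R →+* S) (y z : ℕ → R) :
    ∀ L M, φ (blk y z L M) = blk (fun i => φ (y i)) (fun i => φ (z i)) L M
  | [], M => by simp [blk, map_zblk]
  | [_], [] => by simp [blk]
  | [i], j :: M => by simp [blk, map_zblk, map_lie_ring]
  | i :: j :: L, M => by simp [blk, map_blk φ y z L M, map_lie_ring]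

theorem zblk_eq_zero_of_parity (z : ℕ → R) : ∀ M : List ℕ, ¬ Even M.length → zblk z M = 0
  | [], h => by simp at h
  | [_], _ => rfl
  | i :: j :: M, h => by
    rw [zblk, zblk_eq_zero_of_parity z M (by simpa [Nat.even_add_one] using h), mul_zero]

theorem blk_eq_zero_of_parity (y z : ℕ → R) :
    ∀ L M : List ℕ, ¬ (Even L.length ↔ Even M.length) → blk y z L M = 0
  | [], M, h => zblk_eq_zero_of_parity z M (by simpa using h)
  | [_], [], _ => rfl
  | [i], j :: M, h => by
    rw [blk, zblk_eq_zero_of_parity z M (by simpa [Nat.even_add_one] using h), mul_zero]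
  | i :: j :: L, M, h => by
    rw [blk, blk_eq_zero_of_parity y z L M (by simpa [Nat.even_add_one] using h), mul_zero]

end Blocks

/-- The relations between the generators of the quotient of the free algebra by `I_p`. -/
structure Rels {R : Type*} [Ring R] (p : ℕ) (y z : ℕ → R) : Prop where
  yyy : ∀ i j k, Commute ⁅y i, y j⁆ (y k)
  yyz : ∀ i j k, Commute ⁅y i, y j⁆ (z k)
  yzy : ∀ i j k, Commute ⁅y i, z j⁆ (y k)
  yzz : ∀ i j k, ⁅y i, z j⁆ * z k = -(z k * ⁅y i, z j⁆)
  zzz : ∀ i j k, Commute (circ (z i) (z j)) (z k)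
  vv : ∀ i j k l, circ (z i) (z j) * circ (z k) (z l) = circ (z i) (z k) * circ (z j) (z l)
  yy : ∀ i j k l, ⁅y i, y j⁆ * ⁅y k, y l⁆ = -(⁅y i, y k⁆ * ⁅y j, y l⁆)
  yw : ∀ i j k l, ⁅y i, y j⁆ * ⁅y k, z l⁆ = -(⁅y i, y k⁆ * ⁅y j, z l⁆)
  wv : ∀ i j k l, ⁅y i, z j⁆ * circ (z k) (z l) = ⁅y i, z k⁆ * circ (z j) (z l)
  ww : ∀ i j k l, ⁅y i, z j⁆ * ⁅y k, z l⁆ = -(⁅y i, y k⁆ * circ (z j) (z l))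
  wpow : ∀ i j, ⁅y i, z j⁆ * circ (z j) (z j) ^ ((p - 1) / 2) = 0
  vpow : ∀ i j, circ (z i) (z j) * circ (z j) (z j) ^ ((p - 1) / 2) = 0

namespace Rels

variable {R : Type*} [Ring R] {p : ℕ} {y z : ℕ → R}

theorem zzy (h : Rels p y z) (i j k : ℕ) : Commute (circ (z i) (z j)) (y k) := by
  have h1 := h.yzz k i j
  have h2 := h.yzz k j i
  rw [eq_neg_iff_add_eq_zero] at h1 h2
  have h3 := congrArg₂ (· + ·) h1 h2
  rw [commute_iff_eq, ← sub_eq_zero, ← neg_eq_zero, circ]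
  rw [add_zero] at h3
  rw [← h3]
  simp only [Ring.lie_def]
  noncomm_ring

theorem yy_comm_yz (h : Rels p y z) (i j k l : ℕ) :
    Commute ⁅y i, y j⁆ ⁅y k, z l⁆ := by
  rw [Ring.lie_def (y k)]
  exact ((h.yyy i j k).mul_right (h.yyz i j l)).sub_right ((h.yyz i j l).mul_right (h.yyy i j k))

theorem zblk_swap (h : Rels p y z) : ∀ (P : List ℕ) (i j : ℕ) (M : List ℕ),
    zblk z (P ++ i :: j :: M) = zblk z (P ++ j :: i :: M)
  | [], i, j, M => by simp [zblk, circ, add_comm]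
  | [k], i, j, [] => by simp [zblk]
  | [k], i, j, l :: M => by
    simp only [List.cons_append, List.nil_append, zblk, ← mul_assoc, h.vv k i j l]
  | k :: k' :: P, i, j, M => by
    simp only [List.cons_append, zblk, zblk_swap h P i j M]

theorem blk_swap_right (h : Rels p y z) : ∀ (L P : List ℕ) (i j : ℕ) (M : List ℕ),
    blk y z L (P ++ i :: j :: M) = blk y z L (P ++ j :: i :: M)
  | [], P, i, j, M => h.zblk_swap P i j M
  | [k], [], i, j, [] => by simp [blk, zblk]
  | [k], [], i, j, l :: M => by
    simp only [List.nil_append, blk, zblk, ← mul_assoc, h.wv k i j l]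
  | [k], l :: P, i, j, M => by
    simp only [List.cons_append, blk, h.zblk_swap P i j M]
  | k :: k' :: L, P, i, j, M => by
    simp only [blk, h.blk_swap_right L P i j M]

theorem blk_swap_left (h : Rels p y z) : ∀ (P : List ℕ) (i j : ℕ) (L M : List ℕ),
    blk y z (P ++ i :: j :: L) M = -blk y z (P ++ j :: i :: L) M
  | [], i, j, L, M => by
    simp only [List.nil_append, blk]
    rw [← neg_mul, Ring.lie_def, Ring.lie_def, neg_sub]
  | [k], i, j, [], [] => by simp [blk]
  | [k], i, j, [], m :: M => by
    simp only [List.cons_append, List.nil_append, blk, ← mul_assoc, h.yw k i j m, neg_mul]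
  | [k], i, j, l :: L, M => by
    simp only [List.cons_append, List.nil_append, blk, ← mul_assoc, h.yy k i j l, neg_mul]
  | k :: k' :: P, i, j, L, M => by
    simp only [List.cons_append, blk, h.blk_swap_left P i j L M, mul_neg]

theorem blk_perm_left (h : Rels p y z) {L L' : List ℕ} (hL : L.Perm L') (M : List ℕ) :
    SignEq (blk y z L M) (blk y z L' M) := by
  suffices ∀ P : List ℕ, SignEq (blk y z (P ++ L) M) (blk y z (P ++ L') M) from this []
  induction hL with
  | nil => exact fun P => SignEq.refl _
  | cons x _ ih => exact fun P => by simpa using ih (P ++ [x])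
  | swap i j L => exact fun P => Or.inr (h.blk_swap_left P j i L M)
  | trans _ _ ih₁ ih₂ => exact fun P => (ih₁ P).trans (ih₂ P)

theorem blk_perm_right (h : Rels p y z) (L : List ℕ) {M M' : List ℕ} (hM : M.Perm M') :
    blk y z L M = blk y z L M' := by
  suffices ∀ P : List ℕ, blk y z L (P ++ M) = blk y z L (P ++ M') from this []
  induction hM with
  | nil => exact fun P => rfl
  | cons x _ ih => exact fun P => by simpa using ih (P ++ [x])
  | swap i j M => exact fun P => h.blk_swap_right L P j i M
  | trans _ _ ih₁ ih₂ => exact fun P => (ih₁ P).trans (ih₂ P)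

theorem blk_eq_zero_of_not_nodup (h : Rels p y z) {L : List ℕ} (hL : ¬ L.Nodup) (M : List ℕ) :
    blk y z L M = 0 := by
  obtain ⟨i, hi⟩ := List.exists_duplicate_iff_not_nodup.2 hL
  obtain ⟨L', hL'⟩ := (List.duplicate_iff_sublist.1 hi).exists_perm_append
  exact (h.blk_perm_left hL' M).eq_zero (by simp [blk, Ring.lie_def])

theorem zblk_replicate_append (j : ℕ) (M : List ℕ) : ∀ n : ℕ,
    zblk z (List.replicate (2 * n) j ++ M) = circ (z j) (z j) ^ n * zblk z M
  | 0 => by simp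
  | n + 1 => by
    rw [show 2 * (n + 1) = 2 * n + 1 + 1 by ring]
    simp only [List.replicate_succ, List.cons_append, zblk, zblk_replicate_append j M n, pow_succ',
      mul_assoc]

theorem blk_replicate_append (h : Rels p y z) (hp : Odd p) (j : ℕ) : ∀ L M : List ℕ,
    blk y z L (List.replicate p j ++ M) = 0
  | [], [] => by
    refine blk_eq_zero_of_parity _ _ _ _ ?_
    simpa using hp
  | [], m :: M => by
    obtain ⟨n, rfl⟩ := hp
    rw [h.blk_perm_right [] (M' := m :: j :: (List.replicate (2 * n) j ++ M)) (by
      rw [List.replicate_succ, List.cons_append]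
      exact (List.perm_middle.cons j).trans (List.Perm.swap _ _ _))]
    have := h.vpow m j
    rw [Nat.add_sub_cancel, Nat.mul_div_cancel_left _ two_pos] at this
    rw [blk, zblk, zblk_replicate_append, ← mul_assoc, this, zero_mul]
  | [k], M => by
    obtain ⟨n, rfl⟩ := hp
    have := h.wpow k j
    rw [Nat.add_sub_cancel, Nat.mul_div_cancel_left _ two_pos] at this
    rw [List.replicate_succ, List.cons_append, blk, zblk_replicate_append, ← mul_assoc, this,
      zero_mul]
  | k :: k' :: L, M => by rw [blk, h.blk_replicate_append hp j L M, mul_zero]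

theorem blk_eq_zero_of_le_count (h : Rels p y z) (hp : Odd p) (L : List ℕ) {M : List ℕ} {j : ℕ}
    (hj : p ≤ M.count j) : blk y z L M = 0 := by
  obtain ⟨M', hM'⟩ := (List.replicate_sublist_iff.2 hj).exists_perm_append
  rw [h.blk_perm_right L hM', h.blk_replicate_append hp]

theorem yy_mul_blk (i j : ℕ) (L M : List ℕ) :
    ⁅y i, y j⁆ * blk y z L M = blk y z (i :: j :: L) M := rfl

theorem zz_mul_blk (h : Rels p y z) (i j : ℕ) : ∀ L M : List ℕ,
    circ (z i) (z j) * blk y z L M = blk y z L (i :: j :: M)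
  | [], M => rfl
  | [k], [] => by simp [blk, zblk]
  | [k], m :: M => by
    rw [h.blk_perm_right [k] (M := i :: j :: m :: M) (M' := m :: i :: j :: M)
      (List.perm_middle (l₁ := [i, j]))]
    simp only [blk, zblk, ← mul_assoc, Ring.lie_def]
    rw [(((h.zzy i j k).mul_right (h.zzz i j m)).sub_right
      ((h.zzz i j m).mul_right (h.zzy i j k))).eq]
  | k :: k' :: L, M => by
    rw [blk, blk, ← h.zz_mul_blk i j L M, ← mul_assoc, ← mul_assoc, Ring.lie_def]
    rw [(((h.zzy i j k).mul_right (h.zzy i j k')).sub_right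
      ((h.zzy i j k').mul_right (h.zzy i j k))).eq]

theorem yz_mul_blk (h : Rels p y z) (i j : ℕ) : ∀ L M : List ℕ,
    SignEq (⁅y i, z j⁆ * blk y z L M) (blk y z (i :: L) (j :: M))
  | [], M => SignEq.refl _
  | [k], [] => Or.inl (by simp [blk, zblk])
  | [k], m :: M => Or.inr (by simp only [blk, zblk, ← mul_assoc, h.ww i j k m, neg_mul])
  | k :: k' :: L, M => by
    have h1 := (h.yz_mul_blk i j L M).mul_left ⁅y k, y k'⁆
    rw [← mul_assoc, (h.yy_comm_yz k k' i j).eq, mul_assoc] at h1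
    exact h1.trans (h.blk_perm_left (List.perm_middle (l₁ := [k, k'])) _)

end Rels

section Words

variable {R S : Type*} [Ring R] [Ring S]

/-- The product of the values of `f` along a list. -/
def word (f : ℕ → R) (l : List ℕ) : R := (l.map f).prod

@[simp] theorem word_nil (f : ℕ → R) : word f [] = 1 := rfl

@[simp] theorem word_cons (f : ℕ → R) (i : ℕ) (l : List ℕ) :
    word f (i :: l) = f i * word f l := by simp [word]

theorem map_word (φ : R →+* S) (f : ℕ → R) (l : List ℕ) :
    φ (word f l) = word (fun i => φ (f i)) l := by
  simp [word, map_list_prod, Function.comp_def]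

theorem commute_word {x : R} {f : ℕ → R} (hx : ∀ i, Commute x (f i)) (l : List ℕ) :
    Commute x (word f l) := by
  induction l with
  | nil => exact Commute.one_right x
  | cons i l ih => rw [word_cons]; exact (hx i).mul_right ih

theorem signEq_mul_word {x : R} {f : ℕ → R} (hx : ∀ i, x * f i = -(f i * x)) (l : List ℕ) :
    SignEq (x * word f l) (word f l * x) := by
  induction l with
  | nil => exact Or.inl (by simp)
  | cons i l ih =>
    rw [word_cons, ← mul_assoc, hx, neg_mul, mul_assoc, mul_assoc]
    rcases ih with h | h <;> rw [h]
    · exact Or.inr rfl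
    · exact Or.inl (by simp)

end Words

/-- Index of a candidate normal monomial: the exponents of the even variables, the remaining odd
variables, the even variables and the odd variables of the block of commutators. -/
abbrev NIdx := Multiset ℕ × Finset ℕ × Finset ℕ × Multiset ℕ

/-- The candidate normal monomial with a given index. -/
def nmon {R : Type*} [Ring R] (y z : ℕ → R) (n : NIdx) : R :=
  word y (n.1.sort (· ≤ ·)) * word z (n.2.1.sort (· ≤ ·)) *
    blk y z (n.2.2.1.sort (· ≤ ·)) (n.2.2.2.sort (· ≤ ·))

/-- The indices of normal monomials. -/
def NSet (p : ℕ) : Set NIdx :=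
  {n | (Even n.2.2.1.card ↔ Even n.2.2.2.card) ∧ ∀ j, n.2.2.2.count j < p}

theorem map_nmon {R S : Type*} [Ring R] [Ring S] (φ : R →+* S) (y z : ℕ → R) (n : NIdx) :
    φ (nmon y z n) = nmon (fun i => φ (y i)) (fun i => φ (z i)) n := by
  simp only [nmon, map_mul, map_word, map_blk]

section Span

variable (K : Type*) [Field K] {R : Type*} [Ring R] [Algebra K R] {p : ℕ} {y z : ℕ → R}

/-- The span of products of words and blocks of total word length less than `n`. -/
def wspan (y z : ℕ → R) (n : ℕ) : Submodule K R :=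
  Submodule.span K {x | ∃ a T L M : List ℕ, a.length + T.length < n ∧
    x = word y a * (word z T * blk y z L M)}

variable {K}

theorem mem_wspan {a T : List ℕ} (L M : List ℕ) {n : ℕ} (h : a.length + T.length < n) :
    word y a * (word z T * blk y z L M) ∈ wspan K y z n :=
  Submodule.subset_span ⟨a, T, L, M, h, rfl⟩

theorem SignEq.mem {N : Submodule K R} {a b : R} (h : SignEq a b) (hb : b ∈ N) : a ∈ N := by
  rcases h with rfl | rfl
  · exact hb
  · exact N.neg_mem hb

theorem mul_mem_wspan (i : ℕ) {n : ℕ} {x : R} (hx : x ∈ wspan K y z n) :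
    y i * x ∈ wspan K y z (n + 1) := by
  induction hx using Submodule.span_induction with
  | mem x hx =>
    obtain ⟨a, T, L, M, h, rfl⟩ := hx
    rw [← mul_assoc, ← word_cons]
    exact mem_wspan L M (by simp; omega)
  | zero => simp
  | add _ _ _ _ h₁ h₂ => rw [mul_add]; exact add_mem h₁ h₂
  | smul c _ _ h₁ => rw [mul_smul_comm]; exact Submodule.smul_mem _ c h₁

/-- The span of products of words in the odd variables and blocks of word length less than `n`. -/
def zspan (K : Type*) [Field K] {R : Type*} [Ring R] [Algebra K R] (y z : ℕ → R) (n : ℕ) :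
    Submodule K R :=
  Submodule.span K {x | ∃ T L M : List ℕ, T.length < n ∧ x = word z T * blk y z L M}

theorem mem_zspan {T : List ℕ} (L M : List ℕ) {n : ℕ} (h : T.length < n) :
    word z T * blk y z L M ∈ zspan K y z n :=
  Submodule.subset_span ⟨T, L, M, h, rfl⟩

theorem mul_mem_zspan (i : ℕ) {n : ℕ} {x : R} (hx : x ∈ zspan K y z n) :
    z i * x ∈ zspan K y z (n + 1) := by
  induction hx using Submodule.span_induction with
  | mem x hx =>
    obtain ⟨T, L, M, h, rfl⟩ := hx
    rw [← mul_assoc, ← word_cons]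
    exact mem_zspan L M (by simp; omega)
  | zero => simp
  | add _ _ _ _ h₁ h₂ => rw [mul_add]; exact add_mem h₁ h₂
  | smul c _ _ h₁ => rw [mul_smul_comm]; exact Submodule.smul_mem _ c h₁

theorem word_mul_mem_wspan (a : List ℕ) {n : ℕ} {x : R} (hx : x ∈ zspan K y z n) :
    word y a * x ∈ wspan K y z (a.length + n) := by
  induction hx using Submodule.span_induction with
  | mem x hx =>
    obtain ⟨T, L, M, h, rfl⟩ := hx
    exact mem_wspan L M (by omega)
  | zero => simp
  | add _ _ _ _ h₁ h₂ => rw [mul_add]; exact add_mem h₁ h₂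
  | smul c _ _ h₁ => rw [mul_smul_comm]; exact Submodule.smul_mem _ c h₁

namespace Rels

theorem word_perm_sub_mem (h : Rels p y z) {a a' : List ℕ} (ha : a.Perm a') (T L M : List ℕ) :
    (word y a - word y a') * (word z T * blk y z L M) ∈ wspan K y z (a.length + T.length) := by
  induction ha with
  | nil => simp
  | cons i _ ih =>
    have := mul_mem_wspan i ih
    rw [word_cons, word_cons, ← mul_sub, mul_assoc, List.length_cons, add_right_comm]
    exact this
  | swap i j l =>
    have h1 : (word y (j :: i :: l) - word y (i :: j :: l)) * (word z T * blk y z L M) =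
        word y l * (word z T * blk y z (j :: i :: L) M) := by
      rw [← yy_mul_blk, ← mul_assoc _ ⁅y j, y i⁆, ← (commute_word (h.yyz j i) T).eq,
        mul_assoc ⁅y j, y i⁆, ← mul_assoc (word y l), ← (commute_word (h.yyy j i) l).eq]
      simp only [word_cons, Ring.lie_def]
      noncomm_ring
    rw [h1]
    exact mem_wspan _ _ (by simp)
  | @trans l₁ l₂ l₃ h₁ h₂ ih₁ ih₂ =>
    rw [← h₁.length_eq] at ih₂
    simpa [← add_mul] using add_mem ih₁ ih₂

theorem zword_perm_mem (h : Rels p y z) {T T' : List ℕ} (hT : T.Perm T') :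
    ∃ ε : K, (ε = 1 ∨ ε = -1) ∧ ∀ L M : List ℕ,
      word z T * blk y z L M - ε • (word z T' * blk y z L M) ∈ zspan K y z T.length := by
  induction hT with
  | nil => exact ⟨1, Or.inl rfl, by simp⟩
  | cons i _ ih =>
    obtain ⟨ε, hε, ih⟩ := ih
    refine ⟨ε, hε, fun L M => ?_⟩
    have := mul_mem_zspan i (ih L M)
    rwa [mul_sub, mul_smul_comm, ← mul_assoc, ← mul_assoc, ← word_cons, ← word_cons] at this
  | swap i j l =>
    refine ⟨-1, Or.inr rfl, fun L M => ?_⟩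
    have h1 : word z (j :: i :: l) * blk y z L M - (-1 : K) • (word z (i :: j :: l) * blk y z L M)
        = word z l * blk y z L (j :: i :: M) := by
      rw [← h.zz_mul_blk, ← mul_assoc, ← (commute_word (h.zzz j i) l).eq]
      simp only [word_cons, circ, neg_smul, one_smul]
      noncomm_ring
    rw [h1]
    exact mem_zspan _ _ (by simp)
  | @trans l₁ l₂ l₃ h₁ h₂ ih₁ ih₂ =>
    obtain ⟨ε₁, hε₁, ih₁⟩ := ih₁
    obtain ⟨ε₂, hε₂, ih₂⟩ := ih₂
    refine ⟨ε₁ * ε₂, by rcases hε₁ with rfl | rfl <;> rcases hε₂ with rfl | rfl <;> simp,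
      fun L M => ?_⟩
    have h3 := ih₂ L M
    rw [← h₁.length_eq] at h3
    have := add_mem (ih₁ L M) (Submodule.smul_mem _ ε₁ h3)
    rwa [smul_sub, smul_smul, sub_add_sub_cancel] at this

theorem zword_mem_of_not_nodup (h : Rels p y z) (h2 : (2 : K) ≠ 0) {T : List ℕ}
    (hT : ¬ T.Nodup) (L M : List ℕ) :
    word z T * blk y z L M ∈ zspan K y z T.length := by
  obtain ⟨j, hj⟩ := List.exists_duplicate_iff_not_nodup.2 hT
  obtain ⟨T', hT'⟩ := (List.duplicate_iff_sublist.1 hj).exists_perm_append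
  obtain ⟨ε, -, hε⟩ := h.zword_perm_mem (K := K) hT'
  have h1 := hε L M
  have h3 : word z ([j, j] ++ T') * blk y z L M =
      (2 : K)⁻¹ • (word z T' * blk y z L (j :: j :: M)) := by
    rw [eq_inv_smul_iff₀ h2, ← h.zz_mul_blk, ← mul_assoc, ← (commute_word (h.zzz j j) T').eq,
      two_smul]
    simp only [List.cons_append, List.nil_append, word_cons, circ]
    noncomm_ring
  have h4 : word z ([j, j] ++ T') * blk y z L M ∈ zspan K y z T.length := by
    rw [h3]
    exact Submodule.smul_mem _ _ (mem_zspan _ _ (by simp [hT'.length_eq]))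
  simpa using add_mem h1 (Submodule.smul_mem _ ε h4)

theorem blk_sort_mem (h : Rels p y z) (hp : Odd p) (a : Multiset ℕ) (T : Finset ℕ)
    (L M : List ℕ) :
    word y (a.sort (· ≤ ·)) * (word z (T.sort (· ≤ ·)) * blk y z L M) ∈
      Submodule.span K (nmon y z '' NSet p) := by
  by_cases hL : L.Nodup
  swap
  · simp [h.blk_eq_zero_of_not_nodup hL]
  by_cases hpar : Even L.length ↔ Even M.length
  swap
  · simp [blk_eq_zero_of_parity y z L M hpar]
  by_cases hM : ∀ j, M.count j < p
  swap
  · push Not at hM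
    obtain ⟨j, hj⟩ := hM
    simp [h.blk_eq_zero_of_le_count hp L hj]
  have hL' : (L.toFinset.sort (· ≤ ·)).Perm L := by
    rw [List.perm_ext_iff_of_nodup (Finset.sort_nodup _ _) hL]
    simp
  have hM' : (Multiset.sort (M : Multiset ℕ) (· ≤ ·)).Perm M :=
    Multiset.coe_eq_coe.1 (Multiset.sort_eq _ _)
  refine (((h.blk_perm_left hL'.symm M).mul_left _).mul_left _).mem ?_
  rw [h.blk_perm_right _ hM'.symm, ← mul_assoc]
  refine Submodule.subset_span ⟨(a, T, L.toFinset, (M : Multiset ℕ)), ⟨?_, ?_⟩, rfl⟩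
  · simpa [List.toFinset_card_of_nodup hL] using hpar
  · simpa using hM

theorem wspan_le (h : Rels p y z) (hp : Odd p) (h2 : (2 : K) ≠ 0) (n : ℕ) :
    wspan K y z n ≤ Submodule.span K (nmon y z '' NSet p) := by
  induction n with
  | zero => exact Submodule.span_le.2 (by rintro _ ⟨a, T, L, M, h, -⟩; omega)
  | succ n ih =>
    refine Submodule.span_le.2 ?_
    rintro _ ⟨a, T, L, M, hn, rfl⟩
    have mono : ∀ {m}, m ≤ n → ∀ {x}, x ∈ wspan K y z m →
        x ∈ Submodule.span K (nmon y z '' NSet p) := fun hm x hx =>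
      ih (Submodule.span_mono (by
        rintro _ ⟨a, T, L, M, hlt, rfl⟩; exact ⟨a, T, L, M, by omega, rfl⟩) hx)
    have ha : a.Perm ((a : Multiset ℕ).sort (· ≤ ·)) :=
      (Multiset.coe_eq_coe.1 (Multiset.sort_eq _ _)).symm
    have h1 := mono (by omega) (h.word_perm_sub_mem (K := K) ha T L M)
    suffices h3 : word y ((a : Multiset ℕ).sort (· ≤ ·)) * (word z T * blk y z L M) ∈
        Submodule.span K (nmon y z '' NSet p) by
      rw [sub_mul] at h1
      simpa using add_mem h1 h3
    have hlen : ((a : Multiset ℕ).sort (· ≤ ·)).length = a.length := ha.length_eq.symm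
    by_cases hT : T.Nodup
    · have hT' : T.Perm (T.toFinset.sort (· ≤ ·)) := by
        rw [List.perm_ext_iff_of_nodup hT (Finset.sort_nodup _ _)]
        simp
      obtain ⟨ε, -, hε⟩ := h.zword_perm_mem (K := K) hT'
      have h4 := mono (by omega)
        (word_mul_mem_wspan ((a : Multiset ℕ).sort (· ≤ ·)) (hε L M))
      rw [mul_sub, mul_smul_comm] at h4
      simpa using add_mem h4 (Submodule.smul_mem _ ε (h.blk_sort_mem hp a T.toFinset L M))
    · exact mono (by omega) (word_mul_mem_wspan _ (h.zword_mem_of_not_nodup h2 hT L M))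

theorem z_mul_word (h : Rels p y z) (j : ℕ) (a T L M : List ℕ) :
    ∃ n, z j * (word y a * (word z T * blk y z L M)) ∈ wspan K y z n := by
  induction a with
  | nil =>
    refine ⟨([] : List ℕ).length + (j :: T).length + 1, ?_⟩
    rw [word_nil, one_mul, ← mul_assoc, ← word_cons, ← one_mul (_ * _), ← word_nil y]
    exact mem_wspan _ _ (Nat.lt_succ_self _)
  | cons i a ih =>
    obtain ⟨n, hn⟩ := ih
    have h1 : z j * (word y (i :: a) * (word z T * blk y z L M)) =
        y i * (z j * (word y a * (word z T * blk y z L M))) -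
          word y a * (⁅y i, z j⁆ * word z T * blk y z L M) := by
      rw [mul_assoc ⁅y i, z j⁆, ← mul_assoc (word y a) ⁅y i, z j⁆,
        ← (commute_word (h.yzy i j) a).eq, word_cons, Ring.lie_def]
      noncomm_ring
    have h2 : word y a * (⁅y i, z j⁆ * word z T * blk y z L M) ∈
        wspan K y z (a.length + T.length + 1) := by
      rcases signEq_mul_word (h.yzz i j) T with h3 | h3 <;> rw [h3]
      · rw [mul_assoc]
        exact (((h.yz_mul_blk i j L M).mul_left _).mul_left _).mem (mem_wspan _ _ (by simp))
      · rw [neg_mul, mul_neg, mul_assoc]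
        exact neg_mem ((((h.yz_mul_blk i j L M).mul_left _).mul_left _).mem
          (mem_wspan _ _ (by simp)))
    refine ⟨max (n + 1) (a.length + T.length + 1), ?_⟩
    have mono : ∀ {m n}, m ≤ n → wspan K y z m ≤ wspan K y z n := fun hm =>
      Submodule.span_mono (by
        rintro _ ⟨a, T, L, M, hlt, rfl⟩; exact ⟨a, T, L, M, by omega, rfl⟩)
    rw [h1]
    exact sub_mem (mono (le_max_left _ _) (mul_mem_wspan i hn)) (mono (le_max_right _ _) h2)

end Rels

end Span

/-- The image of the free algebra under a substitution satisfying the relations is spanned by the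
normal monomials. -/
theorem Rels.lift_mem_span {K : Type} [Field K] {R : Type*} [Ring R] [Algebra K R] {p : ℕ}
    {φ : FA K →ₐ[K] R} (h : Rels p (fun i => φ (Yv K i)) (fun i => φ (Zv K i)))
    (hp : Odd p) (h2 : (2 : K) ≠ 0) (f : FA K) :
    φ f ∈ Submodule.span K (nmon (fun i => φ (Yv K i)) (fun i => φ (Zv K i)) '' NSet p) := by
  set y := fun i => φ (Yv K i) with hy
  set z := fun i => φ (Zv K i) with hz
  set N := Submodule.span K (nmon y z '' NSet p)
  have hle := h.wspan_le hp h2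
  let U : Submodule K R := ⨆ n, wspan K y z n
  have mono : Monotone (wspan K y z) := fun m n hm =>
    Submodule.span_mono (by
      rintro _ ⟨a, T, L, M, hlt, rfl⟩; exact ⟨a, T, L, M, by omega, rfl⟩)
  have hU : ∀ x, x ∈ U ↔ ∃ n, x ∈ wspan K y z n := fun x =>
    Submodule.mem_iSup_of_directed _ mono.directed_le
  have hy' : ∀ i, ∀ x ∈ U, y i * x ∈ U := by
    intro i x hx
    obtain ⟨n, hn⟩ := (hU x).1 hx
    exact (hU _).2 ⟨n + 1, mul_mem_wspan i hn⟩
  have hz' : ∀ i, ∀ x ∈ U, z i * x ∈ U := by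
    intro i x hx
    obtain ⟨n, hn⟩ := (hU x).1 hx
    clear hx
    induction hn using Submodule.span_induction with
    | mem x hx =>
      obtain ⟨a, T, L, M, -, rfl⟩ := hx
      exact (hU _).2 (h.z_mul_word i a T L M)
    | zero => simp
    | add u v _ _ h₁ h₂ =>
      rw [mul_add]
      exact add_mem h₁ h₂
    | smul c u _ h₁ =>
      rw [mul_smul_comm]
      exact Submodule.smul_mem _ c h₁
  have key : ∀ x ∈ U, φ f * x ∈ U := by
    induction f using FreeAlgebra.induction with
    | grade0 r =>
      intro x hx
      rw [AlgHom.commutes, ← Algebra.smul_def]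
      exact Submodule.smul_mem _ r hx
    | grade1 v =>
      obtain ⟨_ | _, i⟩ := v
      · exact hy' i
      · exact hz' i
    | mul a b ha hb => intro x hx; rw [map_mul, mul_assoc]; exact ha _ (hb _ hx)
    | add a b ha hb => intro x hx; rw [map_add, add_mul]; exact add_mem (ha _ hx) (hb _ hx)
  have h1 : (1 : R) ∈ U := by
    refine (hU _).2 ⟨1, ?_⟩
    have := mem_wspan (K := K) (y := y) (z := z) (a := []) (T := []) [] [] (n := 1) (by simp)
    simpa [blk, zblk] using this
  have h3 := key 1 h1
  rw [mul_one] at h3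
  obtain ⟨n, hn⟩ := (hU _).1 h3
  exact hle n hn

section Quotient

variable {K : Type} [Field K]

@[simp] theorem ev_Yv {B : Type*} [Ring B] [Algebra K B] (a z : ℕ → B) (i : ℕ) :
    ev K a z (Yv K i) = a i := by simp [ev, Yv]

@[simp] theorem ev_Zv {B : Type*} [Ring B] [Algebra K B] (a z : ℕ → B) (i : ℕ) :
    ev K a z (Zv K i) = z i := by simp [ev, Zv]

theorem Yv_mem_FAdeg (i : ℕ) : Yv K i ∈ FAdeg K 0 :=
  Submodule.subset_span ⟨[(false, i)], by simp, by simp [Yv]⟩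

theorem Zv_mem_FAdeg (i : ℕ) : Zv K i ∈ FAdeg K 1 :=
  Submodule.subset_span ⟨[(true, i)], by simp, by simp [Zv]⟩

theorem Zv_mul_Yv_mem_FAdeg (i j : ℕ) : Zv K i * Yv K j ∈ FAdeg K 1 :=
  Submodule.subset_span ⟨[(true, i), (false, j)], by simp, by simp [Zv, Yv]⟩

theorem subset_T2IdealGen (S : Set (FA K)) {g : FA K} (hg : g ∈ S) : g ∈ T2IdealGen K S :=
  (TwoSidedIdeal.mem_sInf _).2 fun _ hJ => hJ.1 hg

theorem isT2Ideal_T2IdealGen (S : Set (FA K)) : IsT2Ideal K (T2IdealGen K S) :=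
  fun φ hφ _ hx => (TwoSidedIdeal.mem_sInf _).2 fun J hJ =>
    hJ.2 φ hφ _ ((TwoSidedIdeal.mem_sInf _).1 hx J hJ)

/-- The sequence taking the values `x₁, x₂, x₃, x₄` at `1, 2, 3, 4`. -/
def seqFour {α : Type*} (x₁ x₂ x₃ x₄ : α) : ℕ → α
  | 1 => x₁
  | 2 => x₂
  | 3 => x₃
  | _ => x₄

theorem seqFour_mem {α : Type*} {x₁ x₂ x₃ x₄ : α} {s : α → Prop} (h₁ : s x₁) (h₂ : s x₂)
    (h₃ : s x₃) (h₄ : s x₄) (n : ℕ) : s (seqFour x₁ x₂ x₃ x₄ n) := by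
  unfold seqFour; split <;> assumption

theorem circ_self_pow {R : Type*} [Ring R] (x : R) (n : ℕ) :
    circ x x ^ n = x ^ (2 * n) * 2 ^ n := by
  have : circ x x = x ^ 2 * 2 := by rw [circ]; noncomm_ring
  rw [this, (Commute.ofNat_right _ 2).mul_pow, pow_mul]

/-- The quotient of the free algebra by the `T₂`-ideal `I_p`. -/
abbrev IpQuotient (K : Type) [Field K] (p : ℕ) : Type :=
  (T2IdealGen K (gensP K p)).ringCon.Quotient

/-- The quotient map of the free algebra modulo `I_p`. -/
def ipMk (K : Type) [Field K] (p : ℕ) : FA K →ₐ[K] IpQuotient K p :=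
  RingCon.mkₐ K (T2IdealGen K (gensP K p)).ringCon

theorem ipMk_eq_zero_iff {p : ℕ} {f : FA K} :
    ipMk K p f = 0 ↔ f ∈ T2IdealGen K (gensP K p) := by
  rw [TwoSidedIdeal.mem_iff]
  exact RingCon.eq _

theorem ipMk_ev {p : ℕ} {g : FA K} (hg : g ∈ gensP K p) {a z : ℕ → FA K}
    (ha : ∀ i, a i ∈ FAdeg K 0) (hz : ∀ i, z i ∈ FAdeg K 1) : ipMk K p (ev K a z g) = 0 :=
  ipMk_eq_zero_iff.2 (isT2Ideal_T2IdealGen _ _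
    ⟨fun i => by simpa using ha i, fun i => by simpa using hz i⟩ _ (subset_T2IdealGen _ hg))

theorem rels_ipMk {p : ℕ} (hp : Odd p) :
    Rels p (fun i => ipMk K p (Yv K i)) (fun i => ipMk K p (Zv K i)) := by
  have key : ∀ {g}, g ∈ gensP K p → ∀ i₁ i₂ i₃ i₄ j₁ j₂ j₃ j₄ : ℕ,
      ipMk K p (ev K (seqFour (Yv K i₁) (Yv K i₂) (Yv K i₃) (Yv K i₄))
        (seqFour (Zv K j₁) (Zv K j₂) (Zv K j₃) (Zv K j₄)) g) = 0 :=
    fun hg i₁ i₂ i₃ i₄ j₁ j₂ j₃ j₄ => ipMk_ev hg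
      (seqFour_mem (Yv_mem_FAdeg _) (Yv_mem_FAdeg _) (Yv_mem_FAdeg _) (Yv_mem_FAdeg _))
      (seqFour_mem (Zv_mem_FAdeg _) (Zv_mem_FAdeg _) (Zv_mem_FAdeg _) (Zv_mem_FAdeg _))
  have gen : ∀ {g}, g ∈ gens K → g ∈ gensP K p := fun hg => Or.inl hg
  obtain ⟨n, hn⟩ := hp
  have hdiv : (p - 1) / 2 = n := by omega
  have yyy : ∀ i j k, Commute ⁅ipMk K p (Yv K i), ipMk K p (Yv K j)⁆ (ipMk K p (Yv K k)) := by
    intro i j k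
    have := key (g := ⁅⁅Yv K 1, Yv K 2⁆, Yv K 3⁆) (gen (by simp [gens])) i j k 0 0 0 0 0
    simpa only [map_lie_ring, ev_Yv, seqFour, ← commute_iff_lie_eq] using this
  have yyz : ∀ i j k, Commute ⁅ipMk K p (Yv K i), ipMk K p (Yv K j)⁆ (ipMk K p (Zv K k)) := by
    intro i j k
    have := key (g := ⁅⁅Yv K 1, Yv K 2⁆, Zv K 3⁆) (gen (by simp [gens])) i j 0 0 0 0 k 0
    simpa only [map_lie_ring, ev_Yv, ev_Zv, seqFour, ← commute_iff_lie_eq] using this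
  have yzz : ∀ i j k, ⁅ipMk K p (Yv K i), ipMk K p (Zv K j)⁆ * ipMk K p (Zv K k) =
      -(ipMk K p (Zv K k) * ⁅ipMk K p (Yv K i), ipMk K p (Zv K j)⁆) := by
    intro i j k
    have := key (g := circ ⁅Yv K 1, Zv K 2⁆ (Zv K 3)) (gen (by simp [gens])) i 0 0 0 0 j k 0
    simp only [map_lie_ring, map_circ, ev_Yv, ev_Zv, seqFour] at this
    exact eq_neg_of_add_eq_zero_left this
  refine ⟨yyy, yyz, ?_, yzz, ?_, ?_, ?_, ?_, ?_, ?_, ?_, ?_⟩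
  · intro i j k
    have := key (g := ⁅⁅Yv K 1, Zv K 2⁆, Yv K 3⁆) (gen (by simp [gens])) i 0 k 0 0 j 0 0
    simpa only [map_lie_ring, ev_Yv, ev_Zv, seqFour, ← commute_iff_lie_eq] using this
  · intro i j k
    have := key (g := ⁅circ (Zv K 1) (Zv K 2), Zv K 3⁆) (gen (by simp [gens])) 0 0 0 0 i j k 0
    simpa only [map_lie_ring, map_circ, ev_Yv, ev_Zv, seqFour, ← commute_iff_lie_eq] using this
  · intro i j k l
    have := key (g := circ (Zv K 1) (Zv K 2) * circ (Zv K 3) (Zv K 4)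
      - circ (Zv K 1) (Zv K 3) * circ (Zv K 2) (Zv K 4)) (gen (by simp [gens])) 0 0 0 0 i j k l
    simpa only [map_sub, map_mul, map_lie_ring, map_circ, ev_Yv, ev_Zv, seqFour, sub_eq_zero]
      using this
  · intro i j k l
    have := key (g := ⁅Yv K 1, Yv K 2⁆ * ⁅Yv K 3, Yv K 4⁆ + ⁅Yv K 1, Yv K 3⁆ * ⁅Yv K 2, Yv K 4⁆)
      (gen (by simp [gens])) i j k l 0 0 0 0
    simpa only [map_add, map_mul, map_lie_ring, ev_Yv, ev_Zv, seqFour, add_eq_zero_iff_eq_neg]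
      using this
  · intro i j k l
    have := key (g := ⁅Yv K 1, Yv K 2⁆ * ⁅Yv K 3, Zv K 4⁆ + ⁅Yv K 1, Yv K 3⁆ * ⁅Yv K 2, Zv K 4⁆)
      (gen (by simp [gens])) i j k 0 0 0 0 l
    simpa only [map_add, map_mul, map_lie_ring, ev_Yv, ev_Zv, seqFour, add_eq_zero_iff_eq_neg]
      using this
  · intro i j k l
    have := key (g := ⁅Yv K 1, Zv K 2⁆ * circ (Zv K 3) (Zv K 4)
      - ⁅Yv K 1, Zv K 3⁆ * circ (Zv K 2) (Zv K 4)) (gen (by simp [gens])) i 0 0 0 0 j k l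
    simpa only [map_sub, map_mul, map_lie_ring, map_circ, ev_Yv, ev_Zv, seqFour, sub_eq_zero]
      using this
  · intro i j k l
    have h1 := ipMk_ev (p := p) (g := circ ⁅Yv K 1, Zv K 2⁆ (Zv K 3)) (gen (by simp [gens]))
      (a := fun _ => Yv K i) (z := seqFour 0 (Zv K j * Yv K k) (Zv K l) 0)
      (fun _ => Yv_mem_FAdeg _) (seqFour_mem (zero_mem _) (Zv_mul_Yv_mem_FAdeg _ _)
        (Zv_mem_FAdeg _) (zero_mem _))
    simp only [map_lie_ring, map_circ, ev_Yv, ev_Zv, seqFour, map_mul] at h1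
    have h2 := yzz i j l
    have h3 := yyz i k j
    have h4 := yyz i k l
    generalize ipMk K p (Yv K i) = y, ipMk K p (Yv K k) = y', ipMk K p (Zv K j) = z,
      ipMk K p (Zv K l) = z' at *
    have h5 : ⁅y, z * y'⁆ = ⁅y, z⁆ * y' + ⁅y, y'⁆ * z := by
      rw [h3.eq]; simp only [Ring.lie_def]; noncomm_ring
    rw [h5, circ, add_mul, mul_add, ← mul_assoc z', ← neg_eq_iff_eq_neg.2 h2, mul_assoc _ z,
      ← mul_assoc z' _ z, ← h4.eq, mul_assoc _ z'] at h1
    rw [eq_neg_iff_add_eq_zero, ← h1]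
    simp only [circ, Ring.lie_def y' z']
    noncomm_ring
  · intro i j
    have := key (g := prodYZ K (2 * 1 - 1) * (Zv K 1) ^ (2 * n))
      (Or.inr ⟨n, 1, le_rfl, by omega, Or.inr rfl⟩) i i i i j j j j
    simp only [prodYZ, map_mul, map_pow, ev_Zv, seqFour, List.range_succ, List.range_zero,
      List.map_cons, List.map_nil, List.prod_cons, List.prod_nil, mul_one, map_lie_ring, ev_Yv,
      List.nil_append, zero_add] at this
    rw [hdiv, circ_self_pow, ← mul_assoc, this, zero_mul]
  · intro i j
    have := key (g := prodYZ K (2 * 1 - 2) * circ (Zv K 2) (Zv K 1) * (Zv K 1) ^ (2 * n))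
      (Or.inr ⟨n, 1, le_rfl, by omega, Or.inl rfl⟩) 0 0 0 0 j i j j
    simp only [prodYZ, map_mul, map_pow, ev_Zv, seqFour, mul_one, Nat.sub_self, List.range_zero,
      List.map_nil, List.prod_nil, one_mul, map_circ] at this
    rw [hdiv, circ_self_pow, ← mul_assoc, this, zero_mul]

end Quotient

/-- Even elements `s i + η i` and odd elements `u i + v i` whose components satisfy the sign rule of
the canonical `ℤ₂ × ℤ₂`-grading of `E ⊗ E`. -/
structure SignRule {R : Type*} [Ring R] (s η u v : ℕ → R) : Prop where
  central : ∀ i x, Commute (s i) x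
  ηη : ∀ i j, η i * η j = -(η j * η i)
  ηu : ∀ i j, Commute (η i) (u j)
  ηv : ∀ i j, η i * v j = -(v j * η i)
  uu : ∀ i j, u i * u j = -(u j * u i)
  u_sq : ∀ i, u i * u i = 0
  uv : ∀ i j, u i * v j = -(v j * u i)
  vv : ∀ i j, Commute (v i) (v j)

namespace SignRule

variable {R : Type*} [Ring R] {s η u v : ℕ → R}

theorem lie_yy (h : SignRule s η u v) (i j : ℕ) :
    ⁅s i + η i, s j + η j⁆ = 2 * (η i * η j) := by
  rw [Ring.lie_def, add_mul, add_mul, mul_add, mul_add, mul_add, mul_add, (h.central i (s j)).eq,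
    (h.central i (η j)).eq, (h.central j (η i)).eq, h.ηη j i]
  noncomm_ring

theorem lie_yz (h : SignRule s η u v) (i j : ℕ) :
    ⁅s i + η i, u j + v j⁆ = 2 * (η i * v j) := by
  have h1 : v j * η i = -(η i * v j) := by rw [h.ηv, neg_neg]
  rw [Ring.lie_def, add_mul, add_mul, mul_add, mul_add, mul_add, mul_add, (h.central i (u j)).eq,
    (h.central i (v j)).eq, (h.ηu i j).eq, h1]
  noncomm_ring

theorem lie_zy (h : SignRule s η u v) (i j : ℕ) :
    ⁅u j + v j, s i + η i⁆ = -(2 * (η i * v j)) := by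
  rw [← h.lie_yz, Ring.lie_def, Ring.lie_def, neg_sub]

theorem circ_zz (h : SignRule s η u v) (i j : ℕ) :
    circ (u i + v i) (u j + v j) = 2 * (v i * v j) := by
  rw [circ, add_mul, add_mul, mul_add, mul_add, mul_add, mul_add, h.uu i j, h.uv i j, h.uv j i,
    (h.vv j i).eq]
  noncomm_ring

theorem z_sq (h : SignRule s η u v) (i : ℕ) : (u i + v i) ^ 2 = v i ^ 2 := by
  rw [sq, sq, add_mul, mul_add, mul_add, h.u_sq, h.uv i i]
  abel

theorem commute_ηη {i j : ℕ} {x : R} (hi : η i * x = -(x * η i))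
    (hj : η j * x = -(x * η j)) : Commute (η i * η j) x := by
  rw [commute_iff_eq, mul_assoc, hj, mul_neg, ← mul_assoc, hi, neg_mul, neg_neg, mul_assoc]

theorem ηη_η (h : SignRule s η u v) (i j k : ℕ) : Commute (η i * η j) (η k) :=
  commute_ηη (h.ηη i k) (h.ηη j k)

theorem ηη_v (h : SignRule s η u v) (i j k : ℕ) : Commute (η i * η j) (v k) :=
  commute_ηη (h.ηv i k) (h.ηv j k)

theorem ηη_u (h : SignRule s η u v) (i j k : ℕ) : Commute (η i * η j) (u k) :=
  (h.ηu i k).mul_left (h.ηu j k)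

theorem ηv_η (h : SignRule s η u v) (i j k : ℕ) : Commute (η i * v j) (η k) := by
  have h1 : v j * η k = -(η k * v j) := by rw [h.ηv, neg_neg]
  rw [commute_iff_eq, mul_assoc, h1, mul_neg, ← mul_assoc, h.ηη i k, neg_mul, neg_neg, mul_assoc]

theorem ηv_u (h : SignRule s η u v) (i j k : ℕ) : η i * v j * u k = -(u k * (η i * v j)) := by
  have h1 : v j * u k = -(u k * v j) := by rw [h.uv, neg_neg]
  rw [mul_assoc, h1, mul_neg, ← mul_assoc, (h.ηu i k).eq, mul_assoc]

theorem ηv_v (h : SignRule s η u v) (i j k : ℕ) : η i * v j * v k = -(v k * (η i * v j)) := by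
  rw [mul_assoc, (h.vv j k).eq, ← mul_assoc, h.ηv i k, neg_mul, mul_assoc]

theorem vv_u (h : SignRule s η u v) (i j k : ℕ) : Commute (v i * v j) (u k) := by
  have h1 : ∀ j, v j * u k = -(u k * v j) := fun j => by rw [h.uv, neg_neg]
  rw [commute_iff_eq, mul_assoc, h1, mul_neg, ← mul_assoc, h1, neg_mul, neg_neg, mul_assoc]

theorem vv_v (h : SignRule s η u v) (i j k : ℕ) : Commute (v i * v j) (v k) :=
  (h.vv i k).mul_left (h.vv j k)

theorem v_pow_mul_η (h : SignRule s η u v) (j i m : ℕ) : ∃ x, v j ^ m * η i = x * v j ^ m := by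
  induction m with
  | zero => exact ⟨η i, by simp⟩
  | succ m ih =>
    obtain ⟨x, hx⟩ := ih
    have h1 : v j * η i = -(η i * v j) := by rw [h.ηv, neg_neg]
    exact ⟨-x, by rw [pow_succ, mul_assoc, h1, mul_neg, ← mul_assoc, hx, neg_mul, mul_assoc]⟩

end SignRule

section Soundness

variable {K : Type} [Field K]

theorem ev_gens {R : Type*} [Ring R] [Algebra K R] {s η u v : ℕ → R} (h : SignRule s η u v)
    {g : FA K} (hg : g ∈ gens K) :
    ev K (fun i => s i + η i) (fun i => u i + v i) g = 0 := by
  have two : ∀ x y : R, Commute x y → Commute (2 * x) y := fun x y hxy =>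
    (Commute.ofNat_left 2 y).mul_left hxy
  have sc : ∀ i x, Commute x (s i) := fun i x => (h.central i x).symm
  have four : ∀ a b c d : R, 2 * (a * b) * (2 * (c * d)) = 4 * (a * (b * c) * d) := by
    intros; noncomm_ring
  simp only [gens, Set.mem_insert_iff, Set.mem_singleton_iff] at hg
  rcases hg with rfl | rfl | rfl | rfl | rfl | rfl | rfl | rfl | rfl | rfl | rfl <;>
    simp only [map_lie_ring, map_circ, map_add, map_sub, map_mul, ev_Yv, ev_Zv, h.lie_yy,
      h.lie_yz, h.lie_zy, h.circ_zz, ← commute_iff_lie_eq, neg_mul]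
  · exact two _ _ ((sc _ _).add_right (h.ηη_η _ _ _))
  · exact two _ _ ((h.ηη_u _ _ _).add_right (h.ηη_v _ _ _))
  · exact two _ _ ((sc _ _).add_right (h.ηv_η _ _ _))
  · rw [circ, mul_assoc, mul_add, h.ηv_u, h.ηv_v]; noncomm_ring
  · exact two _ _ ((h.vv_u _ _ _).add_right (h.vv_v _ _ _))
  · rw [four, four, (h.vv 2 3).eq, sub_self]
  · rw [four, four, h.ηη 2 3]; noncomm_ring
  · rw [four, four, h.ηη 2 3]; noncomm_ring
  · rw [h.ηv 2 1, h.ηv 3 1]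
    simp only [mul_neg, neg_mul, neg_neg, four, h.ηη 2 3]
    noncomm_ring
  · rw [h.ηv 2 1, h.ηv 3 1]
    simp only [mul_neg, neg_mul, neg_neg, four, h.ηη 2 3]
    noncomm_ring
  · rw [four, four, (h.vv 2 3).eq, sub_self]

theorem ev_prodYZ {R : Type*} [Ring R] [Algebra K R] {s η u v : ℕ → R} (h : SignRule s η u v)
    (m : ℕ) :
    ∃ x, ev K (fun i => s i + η i) (fun i => u i + v i) (prodYZ K m) = x * v 1 ^ m := by
  induction m with
  | zero => exact ⟨1, by simp [prodYZ]⟩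
  | succ m ih =>
    obtain ⟨x, hx⟩ := ih
    have h1 : prodYZ K (m + 1) = prodYZ K m * ⁅Yv K (m + 1), Zv K 1⁆ := by
      simp [prodYZ, List.range_succ]
    obtain ⟨x', hx'⟩ := h.v_pow_mul_η 1 (m + 1) m
    refine ⟨2 * (x * x'), ?_⟩
    rw [h1, map_mul, hx, map_lie_ring, ev_Yv, ev_Zv, h.lie_yz, pow_succ]
    calc x * v 1 ^ m * (2 * (η (m + 1) * v 1)) = 2 * (x * (v 1 ^ m * η (m + 1)) * v 1) := by
          noncomm_ring
      _ = 2 * (x * x') * (v 1 ^ m * v 1) := by rw [hx']; simp only [mul_assoc]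

theorem ev_gensP {R : Type*} [Ring R] [Algebra K R] {s η u v : ℕ → R} (h : SignRule s η u v)
    {p : ℕ} (hv : v 1 ^ p = 0) {g : FA K} (hg : g ∈ gensP K p) :
    ev K (fun i => s i + η i) (fun i => u i + v i) g = 0 := by
  rcases hg with hg | ⟨n, k, hk, hn, rfl | rfl⟩
  · exact ev_gens h hg
  · obtain ⟨x, hx⟩ := ev_prodYZ (K := K) h (2 * k - 2)
    rw [map_mul, map_mul, hx, map_circ, map_pow, ev_Zv, ev_Zv, h.circ_zz, pow_mul, h.z_sq,
      ← pow_mul, (h.vv 2 1).eq]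
    have h1 : v 1 ^ (2 * k - 2) * v 1 * v 1 ^ (2 * n) = 0 := by
      rw [← pow_succ, ← pow_add, ← hv]; congr 1; omega
    calc x * v 1 ^ (2 * k - 2) * (2 * (v 1 * v 2)) * v 1 ^ (2 * n)
        = x * (v 1 ^ (2 * k - 2) * v 1 * ((v 2 * 2) * v 1 ^ (2 * n))) := by
          rw [← (Commute.ofNat_right (v 1 * v 2) 2).eq]
          simp only [mul_assoc]
      _ = x * (v 1 ^ (2 * k - 2) * v 1 * v 1 ^ (2 * n) * (v 2 * 2)) := by
          rw [(((h.vv 2 1).mul_left (Commute.ofNat_left 2 _)).pow_right _).eq]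
          simp only [mul_assoc]
      _ = 0 := by rw [h1, zero_mul, mul_zero]
  · obtain ⟨x, hx⟩ := ev_prodYZ (K := K) h (2 * k - 1)
    rw [map_mul, hx, map_pow, ev_Zv, pow_mul, h.z_sq, ← pow_mul, mul_assoc, ← pow_add,
      show 2 * k - 1 + 2 * n = p by omega, hv, mul_zero]

end Soundness

section Superalgebra

variable (K : Type) [Field K]

/-- The homogeneous component of degree `i` of the canonical grading of the Grassmann algebra. -/
abbrev Ecomp (i : ZMod 2) : Submodule K (E K) :=
  CliffordAlgebra.evenOdd (0 : QuadraticForm K (ℕ →₀ K)) i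

/-- The tensor product of homogeneous components of the two factors of `E ⊗ E`. -/
def EEcomp (i j : ZMod 2) : Submodule K (A K) :=
  Submodule.span K {x | ∃ a ∈ Ecomp K i, ∃ b ∈ Ecomp K j, x = a ⊗ₜ[K] b}

/-- The component `E ⊗ E^j` of `E ⊗ E`. -/
def Rcomp (j : ZMod 2) : Submodule K (A K) :=
  Submodule.span K {x | ∃ a : E K, ∃ b ∈ Ecomp K j, x = a ⊗ₜ[K] b}

variable {K}

theorem Ecomp_mul_mem {i j : ZMod 2} {a b : E K} (ha : a ∈ Ecomp K i) (hb : b ∈ Ecomp K j) :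
    a * b ∈ Ecomp K (i + j) := SetLike.mul_mem_graded ha hb

theorem ι_mul_ι_anticomm (v w : ℕ →₀ K) :
    ExteriorAlgebra.ι K v * ExteriorAlgebra.ι K w =
      -(ExteriorAlgebra.ι K w * ExteriorAlgebra.ι K v) :=
  eq_neg_of_add_eq_zero_left (ExteriorAlgebra.ι_add_mul_swap v w)

theorem commute_ι_mul_ι (v w : ℕ →₀ K) (x : E K) :
    Commute (ExteriorAlgebra.ι K v * ExteriorAlgebra.ι K w) x := by
  induction x using ExteriorAlgebra.induction with
  | algebraMap r => exact (Algebra.commutes r _).symm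
  | ι x =>
    rw [commute_iff_eq, mul_assoc, ι_mul_ι_anticomm w x, mul_neg, ← mul_assoc,
      ι_mul_ι_anticomm v x, neg_mul, neg_neg, mul_assoc]
  | mul a b ha hb => exact ha.mul_right hb
  | add a b ha hb => exact ha.add_right hb

theorem commute_of_mem_Ecomp_zero {a : E K} (ha : a ∈ Ecomp K 0) (x : E K) : Commute a x := by
  induction a, ha using CliffordAlgebra.even_induction with
  | algebraMap r => exact Algebra.commutes r x
  | add a b _ _ ha hb => exact ha.add_left hb
  | ι_mul_ι_mul v w a _ ha => exact (commute_ι_mul_ι v w x).mul_left ha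

theorem ι_mul_of_mem_Ecomp_one (v : ℕ →₀ K) {b : E K} (hb : b ∈ Ecomp K 1) :
    ExteriorAlgebra.ι K v * b = -(b * ExteriorAlgebra.ι K v) := by
  induction b, hb using CliffordAlgebra.odd_induction with
  | ι w => exact ι_mul_ι_anticomm v w
  | add a b _ _ ha hb => rw [mul_add, ha, hb, add_mul, neg_add]
  | ι_mul_ι_mul w w' b _ hb =>
    have h := (commute_ι_mul_ι w w' (ExteriorAlgebra.ι K v)).eq
    change _ * (ExteriorAlgebra.ι K w * ExteriorAlgebra.ι K w' * b) = -(ExteriorAlgebra.ι K w *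
      ExteriorAlgebra.ι K w' * b * _)
    rw [← mul_assoc, ← h, mul_assoc, hb, mul_neg, mul_assoc _ b]

theorem mul_of_mem_Ecomp_one {a b : E K} (ha : a ∈ Ecomp K 1) (hb : b ∈ Ecomp K 1) :
    a * b = -(b * a) := by
  induction a, ha using CliffordAlgebra.odd_induction with
  | ι w => exact ι_mul_of_mem_Ecomp_one w hb
  | add a a' _ _ ha ha' => rw [mul_add, add_mul, ha, ha', neg_add]
  | ι_mul_ι_mul w w' a _ ha =>
    rw [mul_assoc, ha, mul_neg, ← mul_assoc, (commute_ι_mul_ι w w' _).eq, mul_assoc]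

/-- The sign of the supercommutation rule in the Grassmann algebra. -/
def superSign (K : Type) [Field K] (i j : ZMod 2) : K := if i = 1 ∧ j = 1 then -1 else 1

theorem zmod_two_cases (i : ZMod 2) : i = 0 ∨ i = 1 := by
  revert i; decide

theorem Ecomp_supercomm {i j : ZMod 2} {a b : E K} (ha : a ∈ Ecomp K i) (hb : b ∈ Ecomp K j) :
    a * b = superSign K i j • (b * a) := by
  rcases zmod_two_cases i with rfl | rfl
  · simp [superSign, (commute_of_mem_Ecomp_zero ha b).eq]
  rcases zmod_two_cases j with rfl | rfl
  · simp [superSign, (commute_of_mem_Ecomp_zero hb a).eq]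
  · simp [superSign, mul_of_mem_Ecomp_one ha hb]

theorem EEcomp_supercomm {i j i' j' : ZMod 2} {x y : A K} (hx : x ∈ EEcomp K i j)
    (hy : y ∈ EEcomp K i' j') :
    x * y = (superSign K i i' * superSign K j j') • (y * x) := by
  induction hx using Submodule.span_induction with
  | mem x hx =>
    obtain ⟨a, ha, b, hb, rfl⟩ := hx
    induction hy using Submodule.span_induction with
    | mem y hy =>
      obtain ⟨a', ha', b', hb', rfl⟩ := hy
      rw [Algebra.TensorProduct.tmul_mul_tmul, Algebra.TensorProduct.tmul_mul_tmul,
        Ecomp_supercomm ha ha', Ecomp_supercomm hb hb', TensorProduct.smul_tmul_smul]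
    | zero => simp
    | add y y' _ _ h h' => rw [mul_add, h, h', add_mul, smul_add]
    | smul r y _ h => rw [mul_smul_comm, h, smul_mul_assoc, smul_comm]
  | zero => simp
  | add x x' _ _ h h' => rw [add_mul, h, h', mul_add, smul_add]
  | smul r x _ h => rw [smul_mul_assoc, h, mul_smul_comm, smul_comm]

theorem EEcomp_anticomm {i j i' j' : ZMod 2} (h : superSign K i i' * superSign K j j' = -1)
    {x y : A K} (hx : x ∈ EEcomp K i j) (hy : y ∈ EEcomp K i' j') : x * y = -(y * x) := by
  rw [EEcomp_supercomm hx hy, h, neg_one_smul]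

theorem EEcomp_commute {i j i' j' : ZMod 2} (h : superSign K i i' * superSign K j j' = 1)
    {x y : A K} (hx : x ∈ EEcomp K i j) (hy : y ∈ EEcomp K i' j') : Commute x y := by
  rw [commute_iff_eq, EEcomp_supercomm hx hy, h, one_smul]

theorem EEcomp_central {x : A K} (hx : x ∈ EEcomp K 0 0) (y : A K) : Commute x y := by
  induction hx using Submodule.span_induction with
  | mem x hx =>
    obtain ⟨a, ha, b, hb, rfl⟩ := hx
    induction y using TensorProduct.induction_on with
    | zero => exact Commute.zero_right _
    | tmul c d =>
      rw [commute_iff_eq, Algebra.TensorProduct.tmul_mul_tmul, Algebra.TensorProduct.tmul_mul_tmul,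
        (commute_of_mem_Ecomp_zero ha c).eq, (commute_of_mem_Ecomp_zero hb d).eq]
    | add y y' h h' => exact h.add_right h'
  | zero => exact Commute.zero_left _
  | add x x' _ _ h h' => exact h.add_left h'
  | smul r x _ h => exact h.smul_left r

theorem signRule_of_mem (h2 : (2 : K) ≠ 0) {s η u v : ℕ → A K} (hs : ∀ i, s i ∈ EEcomp K 0 0)
    (hη : ∀ i, η i ∈ EEcomp K 1 0) (hu : ∀ i, u i ∈ EEcomp K 0 1) (hv : ∀ i, v i ∈ EEcomp K 1 1) :
    SignRule s η u v where
  central i x := EEcomp_central (hs i) x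
  ηη i j := EEcomp_anticomm (by simp [superSign]) (hη i) (hη j)
  ηu i j := EEcomp_commute (by simp [superSign]) (hη i) (hu j)
  ηv i j := EEcomp_anticomm (by simp [superSign]) (hη i) (hv j)
  uu i j := EEcomp_anticomm (by simp [superSign]) (hu i) (hu j)
  u_sq i := by
    have h : u i * u i = -(u i * u i) := EEcomp_anticomm (by simp [superSign]) (hu i) (hu i)
    rw [eq_neg_iff_add_eq_zero, ← two_smul K, smul_eq_zero] at h
    exact h.resolve_left h2
  uv i j := EEcomp_anticomm (by simp [superSign]) (hu i) (hv j)
  vv i j := EEcomp_commute (by simp [superSign]) (hv i) (hv j)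

theorem pow_char_eq_zero_of_mem {p : ℕ} (hp : p.Prime) (hp2 : 2 < p) [CharP K p] {v : A K}
    (hv : v ∈ EEcomp K 1 1) : v ^ p = 0 := by
  have h2 : (2 : K) ≠ 0 := by
    have := (CharP.cast_eq_zero_iff K p 2).not.2 (Nat.not_dvd_of_pos_of_lt two_pos hp2)
    exact_mod_cast this
  have h0 : (p : A K) = 0 := by
    rw [← map_natCast (algebraMap K (A K)), CharP.cast_eq_zero, map_zero]
  induction hv using Submodule.span_induction with
  | mem x hx =>
    obtain ⟨a, ha, b, hb, rfl⟩ := hx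
    have h : a * a = -(a * a) := mul_of_mem_Ecomp_one ha ha
    rw [eq_neg_iff_add_eq_zero, ← two_smul K, smul_eq_zero] at h
    refine pow_eq_zero_of_le hp2.le ?_
    rw [sq, Algebra.TensorProduct.tmul_mul_tmul, h.resolve_left h2, TensorProduct.zero_tmul]
  | zero => exact zero_pow hp.ne_zero
  | add x y hx hy h h' =>
    obtain ⟨r, hr⟩ := Commute.exists_add_pow_prime_eq hp
      (EEcomp_commute (by simp [superSign]) hx hy : Commute x y)
    rw [hr, h, h', h0]; simp
  | smul c x _ h => rw [smul_pow, h, smul_zero]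

theorem Rcomp_eq_add {j : ZMod 2} {x : A K} (hx : x ∈ Rcomp K j) :
    ∃ y ∈ EEcomp K 0 j, ∃ z ∈ EEcomp K 1 j, x = y + z := by
  suffices Rcomp K j ≤ EEcomp K 0 j ⊔ EEcomp K 1 j by
    obtain ⟨y, hy, z, hz, h⟩ := Submodule.mem_sup.1 (this hx)
    exact ⟨y, hy, z, hz, h.symm⟩
  refine Submodule.span_le.2 ?_
  rintro _ ⟨a, b, hb, rfl⟩
  have ha : a ∈ Ecomp K 0 ⊔ Ecomp K 1 := by
    rw [(CliffordAlgebra.evenOdd_isCompl _).sup_eq_top]; trivial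
  obtain ⟨a₀, ha₀, a₁, ha₁, rfl⟩ := Submodule.mem_sup.1 ha
  rw [TensorProduct.add_tmul]
  exact Submodule.mem_sup.2 ⟨_, Submodule.subset_span ⟨a₀, ha₀, b, hb, rfl⟩, _,
    Submodule.subset_span ⟨a₁, ha₁, b, hb, rfl⟩, rfl⟩

theorem Rcomp_mul_mem {i j : ZMod 2} {x y : A K} (hx : x ∈ Rcomp K i) (hy : y ∈ Rcomp K j) :
    x * y ∈ Rcomp K (i + j) := by
  suffices Rcomp K i * Rcomp K j ≤ Rcomp K (i + j) from this (Submodule.mul_mem_mul hx hy)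
  rw [Rcomp, Rcomp, Submodule.span_mul_span]
  refine Submodule.span_le.2 ?_
  rintro _ ⟨_, ⟨a, b, hb, rfl⟩, _, ⟨a', b', hb', rfl⟩, rfl⟩
  exact Submodule.subset_span ⟨a * a', b * b', Ecomp_mul_mem hb hb',
    Algebra.TensorProduct.tmul_mul_tmul ..⟩

theorem one_mem_Rcomp : (1 : A K) ∈ Rcomp K 0 :=
  Submodule.subset_span ⟨1, 1, SetLike.one_mem_graded (CliffordAlgebra.evenOdd _), rfl⟩

theorem eMon_mem_Ecomp (s : Finset ℕ) : eMon K s ∈ Ecomp K s.card := by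
  rw [eMon, ← Finset.length_sort (· ≤ ·)]
  induction s.sort (· ≤ ·) with
  | nil => exact SetLike.one_mem_graded (CliffordAlgebra.evenOdd _)
  | cons i l ih =>
    rw [List.map_cons, List.prod_cons, List.length_cons, Nat.cast_succ, add_comm]
    exact Ecomp_mul_mem (CliffordAlgebra.ι_mem_evenOdd_one _ _) ih

theorem A0star_le_Rcomp (j : ZMod 2) : A0star K j ≤ Rcomp K j := by
  refine Submodule.span_le.2 ?_
  rintro _ ⟨q, rfl, rfl⟩
  refine Submodule.subset_span ⟨_, _, ?_, rfl⟩
  have h : wdeg (wKstar 0) (wK 0) q = q.2.card := by simp [wdeg, wKstar, wK]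
  rw [h]
  exact eMon_mem_Ecomp q.2

theorem ev_mem_Rcomp {a z : ℕ → A K} (ha : ∀ i, a i ∈ Rcomp K 0) (hz : ∀ i, z i ∈ Rcomp K 1)
    {δ : ZMod 2} {f : FA K} (hf : f ∈ FAdeg K δ) : ev K a z f ∈ Rcomp K δ := by
  induction hf using Submodule.span_induction with
  | mem f hf =>
    obtain ⟨l, rfl, rfl⟩ := hf
    induction l with
    | nil => simpa using one_mem_Rcomp
    | cons v l ih =>
      rw [List.map_cons, List.prod_cons, map_mul]
      rcases v with ⟨_ | _, i⟩
      · have := Rcomp_mul_mem (ha i) ih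
        simpa [ev] using this
      · have := Rcomp_mul_mem (hz i) ih
        simpa [ev, add_comm] using this
  | zero => simp
  | add f g _ _ hf hg => rw [map_add]; exact add_mem hf hg
  | smul r f _ hf => rw [map_smul]; exact Submodule.smul_mem _ _ hf

variable (K) in
/-- The ideal of graded identities of `E ⊗ E` with the grading `Rcomp`. -/
def rightIdentities : TwoSidedIdeal (FA K) :=
  .mk' {f | GIdent K (Rcomp K 0) (Rcomp K 1) f}
    (fun _ _ _ _ => map_zero _)
    (fun hf hg a z ha hz => by rw [map_add, hf a z ha hz, hg a z ha hz, add_zero])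
    (fun hf a z ha hz => by rw [map_neg, hf a z ha hz, neg_zero])
    (fun hf a z ha hz => by rw [map_mul, hf a z ha hz, mul_zero])
    (fun hf a z ha hz => by rw [map_mul, hf a z ha hz, zero_mul])

theorem mem_rightIdentities {f : FA K} :
    f ∈ rightIdentities K ↔ GIdent K (Rcomp K 0) (Rcomp K 1) f :=
  TwoSidedIdeal.mem_mk' ..

theorem isT2Ideal_rightIdentities : IsT2Ideal K (rightIdentities K) := by
  intro φ hφ f hf
  rw [mem_rightIdentities] at hf ⊢
  intro a z ha hz
  have h := hf (fun i => ev K a z (φ (Yv K i))) (fun i => ev K a z (φ (Zv K i)))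
    (fun i => ev_mem_Rcomp ha hz (hφ.1 i)) (fun i => ev_mem_Rcomp ha hz (hφ.2 i))
  rw [← h]
  suffices (ev K a z).comp φ = ev K (fun i => ev K a z (φ (Yv K i)))
    (fun i => ev K a z (φ (Zv K i))) from DFunLike.congr_fun this f
  ext ⟨_ | _, i⟩
  · exact (ev_Yv (fun i => ev K a z (φ (Yv K i))) (fun i => ev K a z (φ (Zv K i))) i).symm
  · exact (ev_Zv (fun i => ev K a z (φ (Yv K i))) (fun i => ev K a z (φ (Zv K i))) i).symm

theorem GIdent_of_mem_T2IdealGen {p : ℕ} (hp2 : 2 < p) [CharP K p] {f : FA K}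
    (hf : f ∈ T2IdealGen K (gensP K p)) : GIdent K (A0star K 0) (A0star K 1) f := by
  have hp : p.Prime := (CharP.char_is_prime_or_zero K p).resolve_right (by omega)
  have h2 : (2 : K) ≠ 0 := by
    have := (CharP.cast_eq_zero_iff K p 2).not.2 (Nat.not_dvd_of_pos_of_lt two_pos hp2)
    exact_mod_cast this
  have h : f ∈ rightIdentities K := by
    refine (TwoSidedIdeal.mem_sInf _).1 hf _ ⟨fun g hg => ?_, isT2Ideal_rightIdentities⟩
    refine mem_rightIdentities.2 fun a z ha hz => ?_
    choose s hs η hη ha using fun i => Rcomp_eq_add (ha i)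
    choose u hu v hv hz using fun i => Rcomp_eq_add (hz i)
    obtain rfl : a = fun i => s i + η i := funext ha
    obtain rfl : z = fun i => u i + v i := funext hz
    exact ev_gensP (signRule_of_mem h2 hs hη hu hv) (pow_char_eq_zero_of_mem hp hp2 (hv 1)) hg
  exact fun a z ha hz => mem_rightIdentities.1 h a z (fun i => A0star_le_Rcomp 0 (ha i))
    fun i => A0star_le_Rcomp 1 (hz i)

end Superalgebra

section Words

variable {R : Type*} [Ring R]

theorem word_append (f : ℕ → R) (l l' : List ℕ) : word f (l ++ l') = word f l * word f l' := by
  simp [word]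

theorem word_eq_zero {f : ℕ → R} {l : List ℕ} {i : ℕ} (hi : i ∈ l) (h : f i = 0) :
    word f l = 0 := by
  obtain ⟨l₁, l₂, rfl⟩ := List.append_of_mem hi
  rw [word_append, word_cons, h, zero_mul, mul_zero]

theorem word_perm {f : ℕ → R} (hf : ∀ i j, Commute (f i) (f j)) {l l' : List ℕ} (h : l.Perm l') :
    word f l = word f l' :=
  (h.map f).prod_eq' (List.pairwise_map.2 (List.pairwise_of_forall hf))

theorem word_eq_zero_of_count {f : ℕ → R} (hf : ∀ i j, Commute (f i) (f j)) {l : List ℕ} {j m : ℕ}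
    (hm : m ≤ l.count j) (h : f j ^ m = 0) : word f l = 0 := by
  obtain ⟨l', hl'⟩ := (List.replicate_sublist_iff.2 hm).exists_perm_append
  rw [word_perm hf hl', word_append, word, List.map_replicate, List.prod_replicate, h, zero_mul]

theorem mul_word_eq_zero {f : ℕ → R} (hf : ∀ i j, f i * f j = -(f j * f i)) {i : ℕ}
    (hi : f i * f i = 0) {l : List ℕ} (hl : i ∈ l) : f i * word f l = 0 := by
  induction l with
  | nil => simp at hl
  | cons j l ih =>
    rw [word_cons, ← mul_assoc]
    rcases List.mem_cons.1 hl with rfl | hl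
    · rw [hi, zero_mul]
    · rw [hf, neg_mul, mul_assoc, ih hl, mul_zero, neg_zero]

theorem add_pow_succ_of_sq_eq_zero {x w : R} (h : Commute x w) (hw : w * w = 0) (n : ℕ) :
    (x + w) ^ (n + 1) = x ^ (n + 1) + (n + 1 : ℕ) * (x ^ n * w) := by
  induction n with
  | zero => simp
  | succ n ih =>
    rw [pow_succ, ih, add_mul, mul_add, mul_add, ← pow_succ, mul_assoc _ _ w, mul_assoc (x ^ n),
      hw, mul_zero, mul_zero, add_zero, mul_assoc _ _ x, mul_assoc (x ^ n), ← h.eq,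
      ← mul_assoc (x ^ n), ← pow_succ]
    push_cast
    noncomm_ring

theorem mul_word_range_eq_zero {w : ℕ → R} (hc : ∀ i j, Commute (w i) (w j))
    (hw : ∀ i, w i * w i = 0) {r m : ℕ} (hr : r < m) : w r * word w (List.range m) = 0 := by
  rw [← word_cons]
  refine word_eq_zero_of_count hc (j := r) (m := 2) ?_ (by rw [sq, hw])
  have : 0 < (List.range m).count r := List.count_pos_iff.2 (List.mem_range.2 hr)
  rw [List.count_cons_self]; omega

theorem sum_range_pow {w : ℕ → R} (hc : ∀ i j, Commute (w i) (w j))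
    (hw : ∀ i, w i * w i = 0) (m : ℕ) :
    (∑ r ∈ Finset.range m, w r) ^ m = (m.factorial : R) * word w (List.range m) := by
  induction m with
  | zero => simp
  | succ m ih =>
    have hs : (∑ r ∈ Finset.range m, w r) * word w (List.range m) = 0 := by
      rw [Finset.sum_mul]
      exact Finset.sum_eq_zero fun r hr => mul_word_range_eq_zero hc hw (Finset.mem_range.1 hr)
    rw [Finset.sum_range_succ, add_pow_succ_of_sq_eq_zero
      (Commute.sum_left _ _ _ fun i _ => hc i m) (hw m), pow_succ', ih, ← mul_assoc,
      ← (Nat.cast_commute m.factorial _).eq, mul_assoc, hs, mul_zero, zero_add, List.range_succ,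
      word_append, Nat.factorial_succ]
    simp [word, mul_assoc]

theorem sum_range_pow_succ {w : ℕ → R} (hc : ∀ i j, Commute (w i) (w j))
    (hw : ∀ i, w i * w i = 0) (m : ℕ) : (∑ r ∈ Finset.range m, w r) ^ (m + 1) = 0 := by
  rw [pow_succ', sum_range_pow hc hw, ← mul_assoc, ← (Nat.cast_commute m.factorial _).eq, mul_assoc,
    Finset.sum_mul, Finset.sum_eq_zero, mul_zero]
  exact fun r hr => mul_word_range_eq_zero hc hw (Finset.mem_range.1 hr)

theorem two_mul_mul_two_pow (x y : R) (k : ℕ) : 2 * x * (2 ^ k * y) = 2 ^ (k + 1) * (x * y) := by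
  rw [pow_succ', mul_assoc, mul_assoc, ← mul_assoc x, ← ((Commute.ofNat_left 2 x).pow_left k).eq,
    mul_assoc]

theorem mul_two_pow_mul_eq_zero {x y : R} (k : ℕ) (h : x * y = 0) : x * (2 ^ k * y) = 0 := by
  rw [← mul_assoc, ← ((Commute.ofNat_left 2 x).pow_left k).eq, mul_assoc, h, mul_zero]

end Words

namespace SignRule

variable {R : Type*} [Ring R] {s η u v : ℕ → R}

theorem zblk_eq (h : SignRule s η u v) : ∀ M : List ℕ, Even M.length →
    ∃ k, zblk (fun i => u i + v i) M = 2 ^ k * word v M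
  | [], _ => ⟨0, by simp [zblk]⟩
  | [_], hM => by simp at hM
  | i :: j :: M, hM => by
    obtain ⟨k, hk⟩ := h.zblk_eq M (by simpa [Nat.even_add_one] using hM)
    refine ⟨k + 1, ?_⟩
    rw [zblk, hk, h.circ_zz, two_mul_mul_two_pow, word_cons, word_cons]
    simp only [mul_assoc]

theorem blk_eq (h : SignRule s η u v) : ∀ L M : List ℕ, (Even L.length ↔ Even M.length) →
    ∃ k, blk (fun i => s i + η i) (fun i => u i + v i) L M = 2 ^ k * (word η L * word v M)
  | [], M, hM => by
    obtain ⟨k, hk⟩ := h.zblk_eq M (by simpa using hM)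
    exact ⟨k, by rw [blk, hk, word_nil, one_mul]⟩
  | [_], [], hM => by simp at hM
  | [i], j :: M, hM => by
    obtain ⟨k, hk⟩ := h.zblk_eq M (by simpa [Nat.even_add_one] using hM)
    refine ⟨k + 1, ?_⟩
    rw [blk, hk, h.lie_yz, two_mul_mul_two_pow, word_cons, word_nil, word_cons]
    simp only [mul_assoc, mul_one]
  | i :: j :: L, M, hM => by
    obtain ⟨k, hk⟩ := h.blk_eq L M (by simpa [Nat.even_add_one] using hM)
    refine ⟨k + 1, ?_⟩
    rw [blk, hk, h.lie_yy, two_mul_mul_two_pow, word_cons, word_cons]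
    simp only [mul_assoc]

/-- Even variables act on a product annihilated by all `η i` and `v j` by scalars. -/
theorem word_y_mul (h : SignRule s η u v) {B : R} (hB : ∀ i, η i * B = 0) (T a : List ℕ) :
    word (fun i => s i + η i) a * (word u T * B) = word s a * (word u T * B) := by
  induction a with
  | nil => rfl
  | cons i a ih =>
    have h1 : Commute (η i) (word s a * word u T) :=
      (commute_word (fun j => (h.central j (η i)).symm) a).mul_right (commute_word (h.ηu i) T)
    rw [word_cons, mul_assoc, ih, add_mul, ← mul_assoc (word s a), ← mul_assoc (η i), h1.eq,
      mul_assoc _ (η i), hB, mul_zero, add_zero, word_cons]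
    simp only [mul_assoc]

/-- Odd variables act on a product annihilated by all `v j` as their components `u j`. -/
theorem word_z_mul (h : SignRule s η u v) {B : R} (hB : ∀ j, v j * B = 0) (T : List ℕ) :
    word (fun i => u i + v i) T * B = word u T * B := by
  induction T with
  | nil => rfl
  | cons j T ih =>
    have h1 : SignEq (v j * word u T) (word u T * v j) :=
      signEq_mul_word (fun i => by rw [h.uv, neg_neg]) T
    have h2 : v j * (word u T * B) = 0 := by
      rw [← mul_assoc]
      rcases h1 with h1 | h1 <;> simp [h1, mul_assoc, hB]
    rw [word_cons, mul_assoc, ih, add_mul, h2, add_zero, word_cons, mul_assoc]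

end SignRule

section Nonvanishing

variable {K : Type} [Field K]

theorem tmul_ne_zero {V W : Type*} [AddCommGroup V] [AddCommGroup W] [Module K V] [Module K W]
    {v : V} {w : W} (hv : v ≠ 0) (hw : w ≠ 0) : v ⊗ₜ[K] w ≠ 0 := by
  intro h
  obtain ⟨f, hf⟩ := not_forall.1 (mt (Module.forall_dual_apply_eq_zero_iff K v).1 hv)
  obtain ⟨g, hg⟩ := not_forall.1 (mt (Module.forall_dual_apply_eq_zero_iff K w).1 hw)
  have h1 := congrArg (TensorProduct.lid K K ∘ TensorProduct.map f g) h
  simp only [Function.comp_apply, TensorProduct.map_tmul, TensorProduct.lid_tmul, map_zero,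
    smul_eq_mul, mul_eq_zero] at h1
  exact h1.elim hf hg

theorem contractLeft_word_eGen {i : ℕ} {l : List ℕ} (hi : i ∉ l) :
    CliffordAlgebra.contractLeft (Q := (0 : QuadraticForm K (ℕ →₀ K)))
      (Finsupp.lapply i : (ℕ →₀ K) →ₗ[K] K) (word (eGen K) l) = 0 := by
  induction l with
  | nil => exact CliffordAlgebra.contractLeft_one (Q := (0 : QuadraticForm K (ℕ →₀ K))) _
  | cons j l ih =>
    rw [List.mem_cons, not_or] at hi
    refine (CliffordAlgebra.contractLeft_ι_mul (Q := (0 : QuadraticForm K (ℕ →₀ K)))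
      (Finsupp.lapply i : (ℕ →₀ K) →ₗ[K] K) (Finsupp.single j 1) (word (eGen K) l)).trans ?_
    rw [ih hi.2, mul_zero, sub_zero, Finsupp.lapply_apply, Finsupp.single_eq_of_ne hi.1, zero_smul]

theorem word_eGen_ne_zero {l : List ℕ} (hl : l.Nodup) : word (eGen K) l ≠ 0 := by
  induction l with
  | nil => exact one_ne_zero
  | cons i l ih =>
    rw [List.nodup_cons] at hl
    intro h
    refine ih hl.2 ?_
    have h1 := (CliffordAlgebra.contractLeft_ι_mul (Q := (0 : QuadraticForm K (ℕ →₀ K)))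
      (Finsupp.lapply i) (Finsupp.single i 1) (word (eGen K) l))
    rw [contractLeft_word_eGen hl.1, mul_zero, sub_zero, Finsupp.lapply_apply,
      Finsupp.single_eq_same, one_smul] at h1
    rw [← h1]
    exact (congrArg _ h).trans (map_zero _)

end Nonvanishing

section Witness

variable (K : Type) [Field K]

/-- Square-zero elements of `E¹ ⊗ E¹` with pairwise disjoint supports. -/
def wEl (q : ℕ) : A K := eGen K (2 * q + 1) ⊗ₜ[K] eGen K (2 * q + 1)

/-- Elements of `E¹ ⊗ E⁰`, nonzero for indices in `S`. -/
def etaEl (S : Finset ℕ) (i : ℕ) : A K := if i ∈ S then eGen K (2 * i) ⊗ₜ[K] 1 else 0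

/-- Elements of `E⁰ ⊗ E¹`, nonzero for indices in `T`. -/
def uEl (T : Finset ℕ) (j : ℕ) : A K := if j ∈ T then 1 ⊗ₜ[K] eGen K (2 * j) else 0

/-- Elements of `E¹ ⊗ E¹`, the `j`-th of which has nilpotency index `m j + 1`. -/
def vEl (m : ℕ → ℕ) (j : ℕ) : A K := ∑ r ∈ Finset.range (m j), wEl K (Nat.pair j r)

variable {K}

theorem eGen_mem_Ecomp (i : ℕ) : eGen K i ∈ Ecomp K 1 := CliffordAlgebra.ι_mem_evenOdd_one _ _

theorem eGen_sq (i : ℕ) : eGen K i * eGen K i = 0 := ExteriorAlgebra.ι_sq_zero _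

theorem one_mem_Ecomp : (1 : E K) ∈ Ecomp K 0 :=
  SetLike.one_mem_graded (CliffordAlgebra.evenOdd _)

theorem wEl_mem (q : ℕ) : wEl K q ∈ EEcomp K 1 1 :=
  Submodule.subset_span ⟨_, eGen_mem_Ecomp _, _, eGen_mem_Ecomp _, rfl⟩

theorem etaEl_mem (S : Finset ℕ) (i : ℕ) : etaEl K S i ∈ EEcomp K 1 0 := by
  unfold etaEl
  split_ifs
  · exact Submodule.subset_span ⟨_, eGen_mem_Ecomp _, _, one_mem_Ecomp, rfl⟩
  · exact zero_mem _

theorem uEl_mem (T : Finset ℕ) (j : ℕ) : uEl K T j ∈ EEcomp K 0 1 := by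
  unfold uEl
  split_ifs
  · exact Submodule.subset_span ⟨_, one_mem_Ecomp, _, eGen_mem_Ecomp _, rfl⟩
  · exact zero_mem _

theorem vEl_mem (m : ℕ → ℕ) (j : ℕ) : vEl K m j ∈ EEcomp K 1 1 :=
  Submodule.sum_mem _ fun _ _ => wEl_mem _

theorem algebraMap_mem_EEcomp (r : K) : algebraMap K (A K) r ∈ EEcomp K 0 0 := by
  rw [Algebra.algebraMap_eq_smul_one]
  exact Submodule.smul_mem _ _ (Submodule.subset_span ⟨1, one_mem_Ecomp, 1, one_mem_Ecomp, rfl⟩)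

theorem signRule_witness (h2 : (2 : K) ≠ 0) (s : ℕ → K) (S T : Finset ℕ) (m : ℕ → ℕ) :
    SignRule (fun i => algebraMap K (A K) (s i)) (etaEl K S) (uEl K T) (vEl K m) :=
  signRule_of_mem h2 (fun _ => algebraMap_mem_EEcomp _) (etaEl_mem S) (uEl_mem T) (vEl_mem m)

theorem mem_A0star {s t : Finset ℕ} {δ : ZMod 2} (h : (t.card : ZMod 2) = δ) :
    eMon K s ⊗ₜ[K] eMon K t ∈ A0star K δ :=
  Submodule.subset_span ⟨(s, t), by simpa [wdeg, wKstar, wK] using h, rfl⟩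

theorem even_mem_A0star (s : ℕ → K) (S : Finset ℕ) (i : ℕ) :
    algebraMap K (A K) (s i) + etaEl K S i ∈ A0star K 0 := by
  refine add_mem ?_ ?_
  · rw [Algebra.algebraMap_eq_smul_one]
    refine Submodule.smul_mem _ _ ?_
    simpa [eMon, Algebra.TensorProduct.one_def] using mem_A0star (K := K) (s := ∅) (t := ∅) rfl
  · unfold etaEl
    split_ifs
    · simpa [eMon] using mem_A0star (K := K) (s := {2 * i}) (t := ∅) rfl
    · exact zero_mem _

theorem odd_mem_A0star (T : Finset ℕ) (m : ℕ → ℕ) (j : ℕ) :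
    uEl K T j + vEl K m j ∈ A0star K 1 := by
  refine add_mem ?_ (Submodule.sum_mem _ fun r _ => ?_)
  · unfold uEl
    split_ifs
    · simpa [eMon] using mem_A0star (K := K) (s := ∅) (t := {2 * j}) rfl
    · exact zero_mem _
  · simpa [eMon, wEl] using mem_A0star (K := K) (s := {2 * Nat.pair j r + 1})
      (t := {2 * Nat.pair j r + 1}) rfl

theorem wEl_commute (q q' : ℕ) : Commute (wEl K q) (wEl K q') :=
  EEcomp_commute (by simp [superSign]) (wEl_mem q) (wEl_mem q')

theorem wEl_sq (q : ℕ) : wEl K q * wEl K q = 0 := by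
  rw [wEl, Algebra.TensorProduct.tmul_mul_tmul, eGen_sq, TensorProduct.zero_tmul]

theorem vEl_pow_succ (m : ℕ → ℕ) (j : ℕ) : vEl K m j ^ (m j + 1) = 0 :=
  sum_range_pow_succ (fun _ _ => wEl_commute _ _) (fun _ => wEl_sq _) _

theorem word_etaEl {S : Finset ℕ} {l : List ℕ} (hl : ∀ i ∈ l, i ∈ S) :
    word (etaEl K S) l = word (eGen K) (l.map (2 * ·)) ⊗ₜ[K] 1 := by
  induction l with
  | nil => rfl
  | cons i l ih =>
    rw [List.forall_mem_cons] at hl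
    rw [word_cons, ih hl.2, etaEl, if_pos hl.1, Algebra.TensorProduct.tmul_mul_tmul, one_mul]
    rfl

theorem word_uEl {T : Finset ℕ} {l : List ℕ} (hl : ∀ i ∈ l, i ∈ T) :
    word (uEl K T) l = 1 ⊗ₜ[K] word (eGen K) (l.map (2 * ·)) := by
  induction l with
  | nil => rfl
  | cons i l ih =>
    rw [List.forall_mem_cons] at hl
    rw [word_cons, ih hl.2, uEl, if_pos hl.1, Algebra.TensorProduct.tmul_mul_tmul, one_mul]
    rfl

theorem word_wEl (l : List ℕ) :
    word (wEl K) l =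
      word (eGen K) (l.map (2 * · + 1)) ⊗ₜ[K] word (eGen K) (l.map (2 * · + 1)) := by
  induction l with
  | nil => rfl
  | cons i l ih =>
    rw [word_cons, ih, wEl, Algebra.TensorProduct.tmul_mul_tmul]
    rfl

theorem word_vEl (m : ℕ → ℕ) (J : List ℕ) :
    word (vEl K m) (J.flatMap fun j => List.replicate (m j) j) =
      ((J.map fun j => ((m j).factorial : K)).prod) •
        word (wEl K) (J.flatMap fun j => (List.range (m j)).map (Nat.pair j)) := by
  induction J with
  | nil => simp
  | cons j J ih =>
    have h1 : vEl K m j ^ m j = ((m j).factorial : A K) *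
        word (wEl K) ((List.range (m j)).map (Nat.pair j)) := by
      rw [vEl, sum_range_pow (fun _ _ => wEl_commute _ _) (fun _ => wEl_sq _), word, word,
        List.map_map]
      rfl
    rw [List.flatMap_cons, List.flatMap_cons, word_append, word_append, ih, List.map_cons,
      List.prod_cons, mul_smul, word, List.map_replicate, List.prod_replicate, h1,
      mul_smul_comm, smul_comm, ← smul_mul_assoc, Nat.cast_smul_eq_nsmul, nsmul_eq_mul,
      smul_mul_assoc, mul_assoc]

theorem sort_perm_flatMap (β : Multiset ℕ) :
    (β.sort (· ≤ ·)).Perm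
      ((β.toFinset.sort (· ≤ ·)).flatMap fun j => List.replicate (β.count j) j) := by
  rw [← Multiset.coe_eq_coe, Multiset.sort_eq, ← Multiset.coe_bind]
  conv_lhs => rw [← Multiset.toFinset_sum_count_nsmul_eq β]
  rw [Finset.sum, Multiset.bind, Multiset.join, ← Finset.sort_eq β.toFinset (· ≤ ·)]
  simp [Multiset.nsmul_singleton, Multiset.coe_replicate]

theorem witness_ne_zero {p : ℕ} (hp : p.Prime) [CharP K p] (S T : Finset ℕ) {β : Multiset ℕ}
    (hβ : ∀ j, β.count j < p) :
    word (uEl K T) (T.sort (· ≤ ·)) * (word (etaEl K S) (S.sort (· ≤ ·)) *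
      word (vEl K fun j => β.count j) (β.sort (· ≤ ·))) ≠ 0 := by
  set Q := (β.toFinset.sort (· ≤ ·)).flatMap
    fun j => (List.range (β.count j)).map (Nat.pair j) with hQ
  have hQn : Q.Nodup := by
    refine List.nodup_flatMap.2 ⟨fun j _ => List.nodup_range.map fun a b h => ?_,
      (Finset.sort_nodup _ _).imp fun {i j} hij => ?_⟩
    · exact (Nat.pair_eq_pair.1 h).2
    · rw [Function.onFun, List.disjoint_left]
      rintro _ h h'
      obtain ⟨a, -, rfl⟩ := List.mem_map.1 h
      obtain ⟨b, -, hb⟩ := List.mem_map.1 h'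
      exact hij (Nat.pair_eq_pair.1 hb).1.symm
  have hw : ∀ S : Finset ℕ, word (eGen K) ((S.sort (· ≤ ·)).map (2 * ·)) *
      word (eGen K) (Q.map (2 * · + 1)) ≠ 0 := by
    intro S
    rw [← word_append]
    refine word_eGen_ne_zero (List.nodup_append.2 ⟨(Finset.sort_nodup _ _).map ?_, hQn.map ?_, ?_⟩)
    · exact fun a b h => by simpa using h
    · exact fun a b h => by simpa using h
    · intro a ha b hb
      obtain ⟨c, -, rfl⟩ := List.mem_map.1 ha
      obtain ⟨d, -, rfl⟩ := List.mem_map.1 hb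
      omega
  rw [word_perm (fun _ _ => EEcomp_commute (by simp [superSign]) (vEl_mem _ _) (vEl_mem _ _))
    (sort_perm_flatMap β), word_vEl, mul_smul_comm, mul_smul_comm]
  refine smul_ne_zero (List.prod_ne_zero ?_) ?_
  · intro h
    obtain ⟨j, -, hj⟩ := List.mem_map.1 h
    rw [CharP.cast_eq_zero_iff K p, hp.dvd_factorial] at hj
    exact (hβ j).not_ge hj
  · rw [word_etaEl (by simp), word_uEl (by simp), word_wEl, Algebra.TensorProduct.tmul_mul_tmul,
      Algebra.TensorProduct.tmul_mul_tmul, one_mul, one_mul]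
    exact tmul_ne_zero (hw S) (hw T)

end Witness

section Evaluation

variable {K : Type} [Field K] (s : ℕ → K)

/-- The even substitution separating the normal monomials. -/
def evenEl (S : Finset ℕ) (i : ℕ) : A K := algebraMap K (A K) (s i) + etaEl K S i

variable (K) in
/-- The odd substitution separating the normal monomials. -/
def oddEl (T : Finset ℕ) (m : ℕ → ℕ) (j : ℕ) : A K := uEl K T j + vEl K m j

variable {s}

theorem uEl_eq_zero {T : Finset ℕ} {j : ℕ} (hj : j ∉ T) : uEl K T j = 0 := if_neg hj

theorem etaEl_eq_zero {S : Finset ℕ} {i : ℕ} (hi : i ∉ S) : etaEl K S i = 0 := if_neg hi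

theorem etaEl_sq (S : Finset ℕ) (i : ℕ) : etaEl K S i * etaEl K S i = 0 := by
  unfold etaEl
  split_ifs
  · rw [Algebra.TensorProduct.tmul_mul_tmul, eGen_sq, TensorProduct.zero_tmul]
  · exact zero_mul _

theorem blk_witness_eq_zero (h2 : (2 : K) ≠ 0) {S S' T : Finset ℕ} {β β' : Multiset ℕ}
    (hpar : Even S'.card ↔ Even β'.card) (hcard : S.card + β.card ≤ S'.card + β'.card)
    (hne : ¬ (S' = S ∧ β' = β)) :
    blk (evenEl s S) (oddEl K T fun j => β.count j) (S'.sort (· ≤ ·)) (β'.sort (· ≤ ·)) = 0 := by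
  have hR := signRule_witness h2 s S T fun j => β.count j
  obtain ⟨k, hk⟩ := hR.blk_eq (S'.sort (· ≤ ·)) (β'.sort (· ≤ ·)) (by simpa using hpar)
  refine hk.trans ?_
  by_cases hS : S' ⊆ S
  · obtain ⟨j, hj⟩ : ∃ j, β.count j < β'.count j := by
      by_contra! hle
      have hβ := Multiset.le_iff_count.2 hle
      have h3 := Finset.card_le_card hS
      have h4 := Multiset.card_le_card hβ
      exact hne ⟨Finset.eq_of_subset_of_card_le hS (by omega),
        Multiset.eq_of_le_of_card_le hβ (by omega)⟩
    rw [word_eq_zero_of_count hR.vv (j := j) (m := β.count j + 1) ?_ (vEl_pow_succ _ j),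
      mul_zero, mul_zero]
    rwa [← Multiset.coe_count, Multiset.sort_eq]
  · obtain ⟨i, hi, hi'⟩ := Finset.not_subset.1 hS
    rw [word_eq_zero ((Finset.mem_sort _).2 hi) (etaEl_eq_zero hi'), zero_mul, mul_zero]

theorem nmon_witness_eq (h2 : (2 : K) ≠ 0) (s : ℕ → K) (S T : Finset ℕ) {β : Multiset ℕ}
    (hpar : Even S.card ↔ Even β.card) : ∃ k, ∀ (a : Multiset ℕ) (T' : Finset ℕ),
    nmon (evenEl s S) (oddEl K T fun j => β.count j) (a, T', S, β) =
      ((a.map s).prod * 2 ^ k) • (word (uEl K T) (T'.sort (· ≤ ·)) *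
        (word (etaEl K S) (S.sort (· ≤ ·)) *
          word (vEl K fun j => β.count j) (β.sort (· ≤ ·)))) := by
  have hR := signRule_witness h2 s S T fun j => β.count j
  obtain ⟨k, hk⟩ := hR.blk_eq (S.sort (· ≤ ·)) (β.sort (· ≤ ·)) (by simpa using hpar)
  refine ⟨k, fun a T' => ?_⟩
  set W := word (etaEl K S) (S.sort (· ≤ ·)) *
    word (vEl K fun j => β.count j) (β.sort (· ≤ ·)) with hW
  have hη : ∀ i, etaEl K S i * (2 ^ k * W) = 0 := fun i => by
    refine mul_two_pow_mul_eq_zero k ?_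
    by_cases hi : i ∈ S
    · rw [hW, ← mul_assoc, mul_word_eq_zero hR.ηη (etaEl_sq S i) ((Finset.mem_sort _).2 hi),
        zero_mul]
    · rw [etaEl_eq_zero hi, zero_mul]
  have hv : ∀ j, vEl K (fun j => β.count j) j * (2 ^ k * W) = 0 := fun j => by
    refine mul_two_pow_mul_eq_zero k ?_
    have h1 : vEl K (fun j => β.count j) j *
        word (vEl K fun j => β.count j) (β.sort (· ≤ ·)) = 0 := by
      rw [← word_cons]
      refine word_eq_zero_of_count hR.vv (j := j) (m := β.count j + 1) ?_ (vEl_pow_succ _ j)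
      rw [List.count_cons_self, ← Multiset.coe_count, Multiset.sort_eq]
    rw [hW, ← mul_assoc]
    rcases signEq_mul_word (x := vEl K (fun j => β.count j) j) (f := etaEl K S)
      (fun i => by rw [hR.ηv, neg_neg]) (S.sort (· ≤ ·)) with h | h <;> rw [h]
    · rw [mul_assoc, h1, mul_zero]
    · rw [neg_mul, mul_assoc, h1, mul_zero, neg_zero]
  have hs : word (fun i => algebraMap K (A K) (s i)) (a.sort (· ≤ ·)) =
      algebraMap K (A K) (a.map s).prod := by
    conv_rhs => rw [← Multiset.sort_eq a (· ≤ ·), Multiset.map_coe, Multiset.prod_coe]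
    exact (map_word (algebraMap K (A K)) s _).symm
  have h3 : nmon (evenEl s S) (oddEl K T fun j => β.count j) (a, T', S, β) =
      algebraMap K (A K) (a.map s).prod *
        (word (uEl K T) (T'.sort (· ≤ ·)) * (2 ^ k * W)) := by
    rw [← hs, ← hR.word_y_mul hη, ← hR.word_z_mul hv, ← hk, nmon, mul_assoc]
    rfl
  have h4 : (2 : A K) ^ k = algebraMap K (A K) (2 ^ k) := by rw [map_pow, map_ofNat]
  rw [h3, h4, ← Algebra.smul_def, ← Algebra.smul_def, mul_smul_comm, smul_smul]

end Evaluation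

section Completeness

variable {K : Type} [Field K]

theorem eq_zero_of_nmon_witness_sum {p : ℕ} (hp : p.Prime) (h2 : (2 : K) ≠ 0)
    [Infinite K] [CharP K p] {c : NIdx →₀ K} (hc : ↑c.support ⊆ NSet p)
    (h : ∀ a z : ℕ → A K, (∀ i, a i ∈ A0star K 0) → (∀ i, z i ∈ A0star K 1) →
      c.sum (fun n r => r • nmon a z n) = 0) : c = 0 := by
  by_contra hne
  obtain ⟨m, hm, hmin⟩ := Finset.exists_min_image c.support
    (fun n : NIdx => toLex (n.2.2.1.card + n.2.2.2.card, n.2.1.card))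
    (Finsupp.support_nonempty_iff.2 hne)
  obtain ⟨b, T, S, β⟩ := m
  simp only [Prod.Lex.toLex_le_toLex] at hmin
  obtain ⟨hpar, hβ⟩ := hc hm
  set X := word (uEl K T) (T.sort (· ≤ ·)) * (word (etaEl K S) (S.sort (· ≤ ·)) *
    word (vEl K fun j => β.count j) (β.sort (· ≤ ·))) with hX
  set P : MvPolynomial ℕ K := ∑ n ∈ c.support with n.2 = (T, S, β),
    MvPolynomial.monomial (Multiset.toFinsupp n.1) (c n) with hP
  have heval : ∀ s : ℕ → K, MvPolynomial.eval s P = 0 := by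
    intro s
    obtain ⟨k, hk⟩ := nmon_witness_eq h2 s S T hpar
    have h1 := h (evenEl s S) (oddEl K T fun j => β.count j) (even_mem_A0star s S)
      (odd_mem_A0star T _)
    have h3 : c.sum (fun n r => r • nmon (evenEl s S) (oddEl K T fun j => β.count j) n) =
        (MvPolynomial.eval s P * 2 ^ k) • X := by
      rw [Finsupp.sum, hP, map_sum, Finset.sum_mul, Finset.sum_smul, Finset.sum_filter]
      refine Finset.sum_congr rfl fun n hn => ?_
      obtain ⟨a, T', S', β'⟩ := n
      have hle : S.card + β.card < S'.card + β'.card ∨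
          S.card + β.card = S'.card + β'.card ∧ T.card ≤ T'.card := hmin _ hn
      split_ifs with heq
      · obtain ⟨rfl, rfl, rfl⟩ : T' = T ∧ S' = S ∧ β' = β := by simpa using heq
        rw [hk, smul_smul, MvPolynomial.eval_monomial, Finsupp.prod,
          Multiset.toFinsupp_support, Finset.prod_multiset_map_count, mul_assoc]
        rfl
      · by_cases hSβ : S' = S ∧ β' = β
        · obtain ⟨rfl, rfl⟩ := hSβ
          have hT : ¬ T' ⊆ T := fun hT => heq <| by
            rw [Finset.eq_of_subset_of_card_le hT (by simpa using hle)]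
          obtain ⟨j, hj, hj'⟩ := Finset.not_subset.1 hT
          rw [hk, word_eq_zero ((Finset.mem_sort _).2 hj) (uEl_eq_zero hj'), zero_mul, smul_zero,
            smul_zero]
        · rw [nmon, blk_witness_eq_zero (S' := S') (β' := β') h2 (hc hn).1 (by omega) hSβ, mul_zero,
            smul_zero]
    rw [h3] at h1
    exact ((mul_eq_zero.1 ((smul_eq_zero.1 h1).resolve_right (witness_ne_zero hp S T hβ)))
      ).resolve_right (pow_ne_zero _ h2)
  have hP0 : P = 0 := MvPolynomial.funext fun s => by rw [heval, map_zero]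
  have hcoeff := congrArg (MvPolynomial.coeff (Multiset.toFinsupp b)) hP0
  rw [hP, MvPolynomial.coeff_sum, Finset.sum_eq_single (b, T, S, β)] at hcoeff
  · exact Finsupp.mem_support_iff.1 hm (by simpa using hcoeff)
  · rintro ⟨a, _⟩ hn hne'
    obtain ⟨-, rfl⟩ := Finset.mem_filter.1 hn
    rw [MvPolynomial.coeff_monomial, if_neg]
    intro hab
    obtain rfl : a = b := Multiset.toFinsupp.injective hab
    exact hne' rfl
  · exact fun hn => (hn (Finset.mem_filter.2 ⟨hm, rfl⟩)).elim

theorem mem_T2IdealGen_of_GIdent [Infinite K] {p : ℕ} (hp2 : 2 < p) [CharP K p] {f : FA K}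
    (hf : GIdent K (A0star K 0) (A0star K 1) f) : f ∈ T2IdealGen K (gensP K p) := by
  have hp : p.Prime := (CharP.char_is_prime_or_zero K p).resolve_right (by omega)
  have h2 : (2 : K) ≠ 0 := by
    have := (CharP.cast_eq_zero_iff K p 2).not.2 (Nat.not_dvd_of_pos_of_lt two_pos hp2)
    exact_mod_cast this
  have hodd : Odd p := hp.odd_of_ne_two (by omega)
  obtain ⟨c, hc, hcf⟩ := (Finsupp.mem_span_image_iff_linearCombination K).1
    ((rels_ipMk (K := K) hodd).lift_mem_span hodd h2 f)
  rw [Finsupp.mem_supported] at hc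
  have hmem : f - c.sum (fun n r => r • nmon (Yv K) (Zv K) n) ∈ T2IdealGen K (gensP K p) := by
    rw [← ipMk_eq_zero_iff, map_sub, ← hcf, Finsupp.linearCombination_apply, map_finsuppSum,
      sub_eq_zero]
    refine Finsupp.sum_congr fun n _ => ?_
    rw [map_smul]
    exact congrArg _ (map_nmon (ipMk K p : FA K →+* IpQuotient K p) _ _ n).symm
  have hc0 : c = 0 := eq_zero_of_nmon_witness_sum hp h2 hc fun a z ha hz => by
    have h1 := GIdent_of_mem_T2IdealGen hp2 hmem a z ha hz
    rw [map_sub, hf a z ha hz, zero_sub, neg_eq_zero, map_finsuppSum] at h1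
    rw [← h1]
    refine Finsupp.sum_congr fun n _ => ?_
    rw [map_smul]
    refine congrArg _ ((map_nmon (ev K a z : FA K →+* A K) (Yv K) (Zv K) n).trans ?_).symm
    simp
  rwa [hc0, Finsupp.sum_zero_index, sub_zero] at hmem

end Completeness

/-- over an infinite field of characteristic `p > 2`,
`T₂(E_{0*} ⊗ E_0) = I_p`, the `T₂`-ideal generated by (1)–(7) together with (8) and (9). -/
theorem T2_eq_Ip_char_p (K : Type) [Field K] [Infinite K] (p : ℕ) (hp : 2 < p) [CharP K p] :
    ∀ f : FA K, GIdent K (A0star K 0) (A0star K 1) f ↔ f ∈ T2IdealGen K (gensP K p) := by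
  exact fun f => ⟨mem_T2IdealGen_of_GIdent hp, GIdent_of_mem_T2IdealGen hp⟩

end Paper
end
end

section
/- Let A = E⊗E be equipped with one of the ℤ₂-gradings E_∞⊗E_k (k ≥ 0), E_∞⊗E_{j*} (j ≥ 0), or E_∞⊗E_∞, and let α(b) denote the ℤ₂-degree of a homogeneous element b in this grading. Given any g_1,…,g_n ∈ ℤ₂×ℤ₂ and h_1,…,h_n ∈ ℤ₂, there exist b_1,…,b_n ∈ B with pairwise disjoint supports such that g(b_i) = g_i and α(b_i) = h_i for all i. -/
open scoped TensorProduct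

noncomputable section

namespace Paper

/-- Every degree and every `E_∞`-weight is attained by a basis monomial of `E` supported on the
two generators with indices `2 * m` and `2 * m + 1`. -/
theorem exists_subset_pair_card_wInf (m : ℕ) (a t : ZMod 2) :
    ∃ s : Finset ℕ, (∀ x ∈ s, x / 2 = m) ∧ (s.card : ZMod 2) = a ∧ ∑ i ∈ s, wInf i = t := by
  have h0 : wInf (2 * m) = 0 := by simp [wInf]
  have h1 : wInf (2 * m + 1) = 1 := by simp [wInf]
  have key : ∀ x : ZMod 2, x = 0 ∨ x = 1 := by decide
  rcases key a with rfl | rfl <;> rcases key t with rfl | rfl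
  · exact ⟨∅, by simp, by simp, by simp⟩
  · refine ⟨{2 * m, 2 * m + 1}, ?_, ?_, ?_⟩
    · intro x hx
      simp only [Finset.mem_insert, Finset.mem_singleton] at hx
      omega
    · rw [Finset.card_pair (by omega)]
      decide
    · rw [Finset.sum_pair (by omega), h0, h1, zero_add]
  · exact ⟨{2 * m}, by simp, by simp, by simp [h0]⟩
  · refine ⟨{2 * m + 1}, ?_, by simp, by simp [h1]⟩
    intro x hx
    simp only [Finset.mem_singleton] at hx
    omega

/-- Every degree is attained by a basis monomial of `E` supported on a single generator. -/
theorem exists_subset_singleton_card (m : ℕ) (a : ZMod 2) :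
    ∃ s : Finset ℕ, (∀ x ∈ s, x = m) ∧ (s.card : ZMod 2) = a := by
  have key : ∀ x : ZMod 2, x = 0 ∨ x = 1 := by decide
  rcases key a with rfl | rfl
  · exact ⟨∅, by simp, by simp⟩
  · exact ⟨{m}, by simp, by simp⟩

/-- Lemma in Section 4: for `A = E⊗E` with one of the gradings
`E_∞⊗E_k`, `E_∞⊗E_{j*}` or `E_∞⊗E_∞`, given any `g_1,…,g_n ∈ ℤ₂×ℤ₂` and
`h_1,…,h_n ∈ ℤ₂` there exist canonical basis elements `b_1,…,b_n` with pairwise disjoint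
supports such that `g(b_i) = g_i` and `α(b_i) = h_i`. -/
theorem exists_basis_elements_inf (K : Type) [Field K] [Infinite K] (h2 : (2 : K) ≠ 0)
    (w₂ : ℕ → ZMod 2)
    (hw : w₂ = wInf ∨ (∃ k, w₂ = wK k) ∨ (∃ j, w₂ = wKstar j))
    (n : ℕ) (g : Fin n → ZMod 2 × ZMod 2) (h : Fin n → ZMod 2) :
    ∃ q : Fin n → Finset ℕ × Finset ℕ,
      (∀ i i', i ≠ i' → Disjoint (q i).1 (q i').1 ∧ Disjoint (q i).2 (q i').2) ∧
      (∀ i, gdeg (q i) = g i) ∧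
      (∀ i, wdeg wInf w₂ (q i) = h i) := by
  choose v hv hvcard using fun i : Fin n => exists_subset_singleton_card i (g i).2
  choose u hu hucard husum using fun i : Fin n =>
    exists_subset_pair_card_wInf i (g i).1 (h i - ∑ j ∈ v i, w₂ j)
  refine ⟨fun i => (u i, v i), fun i i' hne => ⟨?_, ?_⟩, fun i => ?_, fun i => ?_⟩
  · exact Finset.disjoint_left.2 fun x hx hx' =>
      hne (Fin.ext ((hu i x hx).symm.trans (hu i' x hx')))
  · exact Finset.disjoint_left.2 fun x hx hx' =>
      hne (Fin.ext ((hv i x hx).symm.trans (hv i' x hx')))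
  · exact Prod.ext (hucard i) (hvcard i)
  · simp only [wdeg, husum, sub_add_cancel]

end Paper
end
end

section
/- For all k, j ≥ 0, the polynomial z_1 z_2 ⋯ z_{j+k+1} is a 2-graded identity of E_{k*}⊗E_{j*}; that is, for any j+k+1 elements b_1,…,b_{j+k+1} of odd degree in the grading E_{k*}⊗E_{j*}, the product b_1 b_2 ⋯ b_{j+k+1} = 0. -/
open scoped TensorProduct

noncomputable section

namespace Paper

theorem eGen_prod_eq_zero_of_not_nodup (K : Type) [Field K] {l : List ℕ} (hl : ¬ l.Nodup) :
    (l.map (eGen K)).prod = 0 := by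
  rw [List.nodup_iff_injective_get] at hl
  have h := (ExteriorAlgebra.ιMulti K l.length).map_eq_zero_of_not_injective
    (fun i => (Finsupp.single (l.get i) 1 : ℕ →₀ K)) fun h => hl fun a b hab =>
      h (congrArg (fun i => (Finsupp.single i 1 : ℕ →₀ K)) hab)
  rw [ExteriorAlgebra.ιMulti_apply] at h
  rw [← h]
  conv_lhs => rw [← List.ofFn_get l, List.map_ofFn]
  rfl

theorem countP_lt_le_of_nodup {l : List ℕ} (hl : l.Nodup) (k : ℕ) :
    l.countP (fun i => decide (i < k)) ≤ k := by
  rw [List.countP_eq_length_filter, ← List.toFinset_card_of_nodup (hl.filter _)]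
  calc _ ≤ (Finset.range k).card := Finset.card_le_card fun i hi => by simp_all
    _ = k := Finset.card_range k

theorem sum_wKstar_eq_zero {s : Finset ℕ} {k : ℕ}
    (h : (s.sort (· ≤ ·)).countP (fun i => decide (i < k)) = 0) :
    ∑ i ∈ s, wKstar k i = 0 := by
  refine Finset.sum_eq_zero fun i hi => ?_
  rw [List.countP_eq_zero] at h
  have := h i (by simpa using hi)
  simp_all [wKstar]

/-- The span of the tensor products of words in the generators in which generators of odd
degree for `E_{k*} ⊗ E_{j*}` occur at least `n` times. -/
def oddFiltration (K : Type) [Field K] (k j n : ℕ) : Submodule K (A K) :=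
  Submodule.span K { a | ∃ l m : List ℕ,
    n ≤ l.countP (fun i => decide (i < k)) + m.countP (fun i => decide (i < j)) ∧
    a = (l.map (eGen K)).prod ⊗ₜ[K] (m.map (eGen K)).prod }

theorem Agr_one_le_oddFiltration (K : Type) [Field K] (k j : ℕ) :
    Agr K (wKstar k) (wKstar j) 1 ≤ oddFiltration K k j 1 := by
  refine Submodule.span_mono ?_
  rintro _ ⟨q, hq, rfl⟩
  refine ⟨q.1.sort (· ≤ ·), q.2.sort (· ≤ ·), ?_, rfl⟩
  by_contra! h
  rw [wdeg, sum_wKstar_eq_zero (by omega), sum_wKstar_eq_zero (by omega)] at hq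
  simp at hq

theorem mul_mem_oddFiltration (K : Type) [Field K] {k j n n' : ℕ} {x y : A K}
    (hx : x ∈ oddFiltration K k j n) (hy : y ∈ oddFiltration K k j n') :
    x * y ∈ oddFiltration K k j (n + n') := by
  have h := Submodule.mul_mem_mul hx hy
  rw [oddFiltration, oddFiltration, Submodule.span_mul_span] at h
  refine Submodule.span_mono ?_ h
  rintro _ ⟨_, ⟨l, m, hlm, rfl⟩, _, ⟨l', m', hlm', rfl⟩, rfl⟩
  refine ⟨l ++ l', m ++ m', ?_, ?_⟩
  · simp only [List.countP_append]
    omega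
  · simp [Algebra.TensorProduct.tmul_mul_tmul]

theorem list_prod_mem_oddFiltration (K : Type) [Field K] {k j : ℕ} (l : List (A K))
    (hl : ∀ x ∈ l, x ∈ oddFiltration K k j 1) : l.prod ∈ oddFiltration K k j l.length := by
  induction l with
  | nil => exact Submodule.subset_span ⟨[], [], by simp, by simp [Algebra.TensorProduct.one_def]⟩
  | cons x l ih =>
    rw [List.prod_cons, List.length_cons, add_comm]
    exact mul_mem_oddFiltration K (hl x (by simp)) (ih fun y hy => hl y (by simp [hy]))

theorem oddFiltration_eq_bot (K : Type) [Field K] (k j : ℕ) :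
    oddFiltration K k j (j + k + 1) = ⊥ := by
  rw [oddFiltration, Submodule.span_eq_bot]
  rintro _ ⟨l, m, h, rfl⟩
  by_cases hl : l.Nodup
  · by_cases hm : m.Nodup
    · have := countP_lt_le_of_nodup hl k
      have := countP_lt_le_of_nodup hm j
      omega
    · rw [eGen_prod_eq_zero_of_not_nodup K hm, TensorProduct.tmul_zero]
  · rw [eGen_prod_eq_zero_of_not_nodup K hl, TensorProduct.zero_tmul]

theorem list_prod_eq_zero_of_mem_Agr_one (K : Type) [Field K] {k j : ℕ} (l : List (A K))
    (hlen : l.length = j + k + 1) (hl : ∀ x ∈ l, x ∈ Agr K (wKstar k) (wKstar j) 1) :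
    l.prod = 0 := by
  have h := list_prod_mem_oddFiltration K l fun x hx => Agr_one_le_oddFiltration K k j (hl x hx)
  rwa [hlen, oddFiltration_eq_bot, Submodule.mem_bot] at h

/-- the polynomial `z_1 z_2 ⋯ z_{j+k+1}` is a 2-graded identity of
`E_{k*} ⊗ E_{j*}`; that is, any product of `j+k+1` elements of odd degree vanishes. -/
theorem z_product_identity (K : Type) [Field K] [Infinite K] (h2 : (2 : K) ≠ 0)
    (k j : ℕ) :
    GIdent K (Agr K (wKstar k) (wKstar j) 0) (Agr K (wKstar k) (wKstar j) 1)
      (((List.range (j + k + 1)).map (Zv K)).prod) ∧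
    (∀ b : Fin (j + k + 1) → A K,
      (∀ i, b i ∈ Agr K (wKstar k) (wKstar j) 1) → (List.ofFn b).prod = 0) := by
  refine ⟨fun a z _ hz => ?_, fun b hb => ?_⟩
  · rw [map_list_prod, List.map_map]
    refine list_prod_eq_zero_of_mem_Agr_one K (k := k) (j := j) _ (by simp) fun x hx => ?_
    obtain ⟨i, -, rfl⟩ := List.mem_map.1 hx
    simpa [ev, Zv] using hz i
  · refine list_prod_eq_zero_of_mem_Agr_one K (k := k) (j := j) _ (by simp) fun x hx => ?_
    obtain ⟨i, rfl⟩ := (List.mem_ofFn' b x).1 hx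
    exact hb i

end Paper
end
end

section
/- Let k, j ≥ 0 and let A = E⊗E carry the ℤ₂-grading E_{k*}⊗E_{j*}, with α(b) denoting the ℤ₂-degree of a homogeneous element b in this grading. Given g_1,…,g_n ∈ ℤ₂×ℤ₂ and h_1,…,h_n ∈ ℤ₂, if the number of indices i ∈ {1,…,n} with h_i = 1 is at most k + j, then there exist b_1,…,b_n ∈ B with pairwise disjoint supports such that g(b_i) = g_i and α(b_i) = h_i for all i. -/
open scoped TensorProduct

noncomputable section

namespace Paper

/-- A pairwise disjoint family of subsets of `{0, …, k - 1}` can be enlarged by generators of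
weight `0` so as to have prescribed cardinalities modulo `2`. -/
theorem exists_pad_card (k : ℕ) {n : ℕ} (S : Fin n → Finset ℕ) (hS : ∀ i, ∀ a ∈ S i, a < k)
    (hd : Pairwise fun i i' => Disjoint (S i) (S i')) (x : Fin n → ZMod 2) :
    ∃ T : Fin n → Finset ℕ, (Pairwise fun i i' => Disjoint (T i) (T i')) ∧
      (∀ i, ((T i).card : ZMod 2) = x i) ∧
      ∀ i, ∑ a ∈ T i, wKstar k a = ((S i).card : ZMod 2) := by
  have hsum : ∀ i, ∑ a ∈ S i, wKstar k a = ((S i).card : ZMod 2) := by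
    intro i
    rw [Finset.sum_congr rfl fun a ha => by rw [wKstar, if_pos (hS i a ha)]]
    simp
  have hnot : ∀ i m, k + m ∉ S i := fun i m hm => by have := hS i _ hm; omega
  refine ⟨fun i => if ((S i).card : ZMod 2) = x i then S i else insert (k + i) (S i), ?_, ?_, ?_⟩
  · intro i i' hii
    have h1 := hd hii
    have h3 : (i : ℕ) ≠ i' := fun h => hii (Fin.ext h)
    dsimp only
    split_ifs <;> simp [hnot, h1, h3.symm]
  · intro i
    dsimp only
    split_ifs with hc
    · exact hc
    · rw [Finset.card_insert_of_notMem (hnot i i), Nat.cast_add, Nat.cast_one]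
      generalize ((S i).card : ZMod 2) = u at hc ⊢
      generalize x i = v at hc ⊢
      revert u v
      decide
  · intro i
    dsimp only
    split_ifs
    · exact hsum i
    · rw [Finset.sum_insert (hnot i i), hsum i]
      simp [wKstar]

/-- for `A = E⊗E` with the grading `E_{k*} ⊗ E_{j*}`, given
`g_1,…,g_n ∈ ℤ₂×ℤ₂` and `h_1,…,h_n ∈ ℤ₂` with at most `k+j` of the `h_i` equal to `1`,
there exist canonical basis elements `b_1,…,b_n` with pairwise disjoint supports such that
`g(b_i) = g_i` and `α(b_i) = h_i`. -/
theorem exists_basis_elements_kstar (K : Type) [Field K] [Infinite K] (h2 : (2 : K) ≠ 0)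
    (k j : ℕ) (n : ℕ) (g : Fin n → ZMod 2 × ZMod 2) (h : Fin n → ZMod 2)
    (hcard : (Finset.univ.filter fun i => h i = 1).card ≤ k + j) :
    ∃ q : Fin n → Finset ℕ × Finset ℕ,
      (∀ i i', i ≠ i' → Disjoint (q i).1 (q i').1 ∧ Disjoint (q i).2 (q i').2) ∧
      (∀ i, gdeg (q i) = g i) ∧
      (∀ i, wdeg (wKstar k) (wKstar j) (q i) = h i) := by
  obtain ⟨c, hc, hinj⟩ : ∃ c : Fin n → ℕ, (∀ i, h i = 1 → c i < k + j) ∧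
      ∀ i i', h i = 1 → h i' = 1 → c i = c i' → i = i' := by
    let e := (Finset.univ.filter fun i => h i = 1).equivFin
    have hmem : ∀ i, h i = 1 → i ∈ Finset.univ.filter fun i => h i = 1 := by simp
    refine ⟨fun i => if hi : h i = 1 then e ⟨i, hmem i hi⟩ else 0, fun i hi => ?_,
      fun i i' hi hi' hii => ?_⟩
    · simp only [dif_pos hi]
      exact (e _).isLt.trans_le hcard
    · simp only [dif_pos hi, dif_pos hi'] at hii
      exact congrArg Subtype.val (e.injective (Fin.ext hii))
  obtain ⟨T₁, hd₁, hg₁, hw₁⟩ := exists_pad_card k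
    (fun i => if h i = 1 ∧ c i < k then {c i} else ∅)
    (by intro i a ha; split_ifs at ha <;> simp_all)
    (by
      intro i i' hii
      split_ifs with h₁ h₂ <;> simp only [Finset.disjoint_empty_left,
        Finset.disjoint_empty_right, Finset.disjoint_singleton]
      exact fun he => hii (hinj i i' h₁.1 h₂.1 (by omega)))
    (fun i => (g i).1)
  obtain ⟨T₂, hd₂, hg₂, hw₂⟩ := exists_pad_card j
    (fun i => if h i = 1 ∧ k ≤ c i then {c i - k} else ∅)
    (by
      intro i a ha
      split_ifs at ha with h₁
      · have := hc i h₁.1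
        rw [Finset.mem_singleton] at ha
        omega
      · simp at ha)
    (by
      intro i i' hii
      split_ifs with h₁ h₂ <;> simp only [Finset.disjoint_empty_left,
        Finset.disjoint_empty_right, Finset.disjoint_singleton]
      exact fun he => hii (hinj i i' h₁.1 h₂.1 (by omega)))
    (fun i => (g i).2)
  refine ⟨fun i => (T₁ i, T₂ i), fun i i' hii => ⟨hd₁ hii, hd₂ hii⟩,
    fun i => Prod.ext (hg₁ i) (hg₂ i), fun i => ?_⟩
  simp only [wdeg, hw₁, hw₂]
  by_cases hi : h i = 1
  · rcases lt_or_ge (c i) k with hk | hk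
    · simp [hi, hk, not_le.mpr hk]
    · simp [hi, hk, not_lt.mpr hk]
  · have h0 : ∀ u : ZMod 2, u ≠ 1 → 0 = u := by decide
    simpa [hi] using h0 _ hi

end Paper
end
end
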